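/- Let f be a probability mass function on the positive integers whose mean E[d] = ∑_{t≥1} t·f(t) and 4/3-moment ∑_{t≥1} t^{4/3}·f(t) are both finite. For each n, let D_n be the distribution on {1,2,…,⌊√n/(log n)²⌋} with probability of t proportional to f(t); draw degrees d_1,…,d_n i.i.d. from D_n, generate a graph from the erased configuration model ECM(d), and form MinBucket buckets (with an edge between two vertices of equal final degree placed in both endpoints' buckets); let X_{i,n} be the number of edges in vertex i's bucket. Then the limit as n → ∞ of (1/n)·E[∑_{i=1}^n X_{i,n}(X_{i,n}−1)/2] exists and equals (1/(2·E[d]²))·∑_{t₁=1}^∞ ∑_{t₂=t₁}^∞ ∑_{t₃=t₁}^∞ t₁(t₁−1)·t₂·t₃·f(t₁)f(t₂)f(t₃), which is a finite number. -/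

import Mathlib

open Finset

noncomputable section
attribute [local instance] Classical.propDecidable

/-- The perfect matchings of the stub set `Fin N`: fixed-point-free involutions. -/
def matchings (N : ℕ) : Finset (Equiv.Perm (Fin N)) :=
  Finset.univ.filter fun M => ∀ s, M (M s) = s ∧ M s ≠ s

/-- Adjacency in the erased (simple) graph: distinct vertices joined by a matched stub pair. -/
def ecmAdj {n N : ℕ} (φ : Fin N → Fin n) (M : Equiv.Perm (Fin N)) (u v : Fin n) : Prop :=
  u ≠ v ∧ ∃ s, φ s = u ∧ φ (M s) = v

/-- The degree `D_v` of vertex `v` in the erased graph. -/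
def ecmDeg {n N : ℕ} (φ : Fin N → Fin n) (M : Equiv.Perm (Fin N)) (v : Fin n) : ℕ :=
  (Finset.univ.filter fun u => ecmAdj φ M u v).card

/-- In this section an edge `(v,w)` is placed in `v`'s bucket whenever `D_v ≤ D_w`
(so an edge between equal-degree endpoints is counted in both buckets). -/
def inBucket₂ {n N : ℕ} (φ : Fin N → Fin n) (M : Equiv.Perm (Fin N)) (v w : Fin n) : Prop :=
  ecmAdj φ M v w ∧ ecmDeg φ M v ≤ ecmDeg φ M w

/-- `X_v`, the number of edges in `v`'s bucket. -/
def ecmX₂ {n N : ℕ} (φ : Fin N → Fin n) (M : Equiv.Perm (Fin N)) (v : Fin n) : ℝ :=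
  ∑ w, if inBucket₂ φ M v w then (1 : ℝ) else 0

/-- `φ` is a stub map for `d` with at most one stub discarded: every vertex owns at most
its prescribed number of stubs, and in total at most one stub is missing (this happens
exactly when `∑ d_v` is odd). -/
def IsAlmostStubMap {n N : ℕ} (d : Fin n → ℕ) (φ : Fin N → Fin n) : Prop :=
  (∀ v, (Finset.univ.filter fun s => φ s = v).card ≤ d v) ∧
    (∑ v, (d v - (Finset.univ.filter fun s => φ s = v).card)) ≤ 1

/-- The expected MinBucket work `E[∑_v X_v (X_v - 1) / 2]` for the erased configuration
model on the degree sequence `d` (with `2⌊∑ d_v / 2⌋` stubs, i.e. one stub discarded if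
`∑ d_v` is odd), averaged uniformly over stub maps and perfect matchings. -/
def ecmWork {n : ℕ} (d : Fin n → ℕ) : ℝ :=
  (∑ φ ∈ (Finset.univ :
        Finset (Fin (2 * ((∑ v, d v) / 2)) → Fin n)).filter (IsAlmostStubMap d),
      ∑ M ∈ matchings (2 * ((∑ v, d v) / 2)),
        ∑ v, ecmX₂ φ M v * (ecmX₂ φ M v - 1) / 2) /
    ((((Finset.univ :
          Finset (Fin (2 * ((∑ v, d v) / 2)) → Fin n)).filter (IsAlmostStubMap d)).card : ℝ) *
      ((matchings (2 * ((∑ v, d v) / 2))).card : ℝ))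

/-- The degree cutoff `M(n) = ⌊√n / (log n)²⌋`. -/
def degCap (n : ℕ) : ℕ := ⌊Real.sqrt n / (Real.log n) ^ 2⌋₊

/-- `E[∑_v X_v (X_v-1)/2]` where the degrees `d_1, …, d_n` are drawn i.i.d. from the
distribution on `{1, …, M(n)}` with mass proportional to `f`, and then a graph is drawn
from `ECM(d)`. -/
def expectedWork (f : ℕ → ℝ) (n : ℕ) : ℝ :=
  ∑ dd ∈ Fintype.piFinset (fun _ : Fin n => Finset.Icc 1 (degCap n)),
    ((∏ i, f (dd i)) / (∑ t ∈ Finset.Icc 1 (degCap n), f t) ^ n) * ecmWork dd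

/-- The average of `F` over a uniformly random perfect matching. -/
def matchAvg {N : ℕ} (F : Equiv.Perm (Fin N) → ℝ) : ℝ :=
  (∑ M ∈ matchings N, F M) / ((matchings N).card : ℝ)

lemma mem_matchings {N : ℕ} {M : Equiv.Perm (Fin N)} :
    M ∈ matchings N ↔ ∀ s, M (M s) = s ∧ M s ≠ s := by
  simp [matchings]

lemma matchings_card_pos (m : ℕ) : 0 < (matchings (2 * m)).card := by
  refine Finset.card_pos.2 ⟨Fin.revPerm, mem_matchings.2 fun s => ⟨by simp, fun h => ?_⟩⟩
  have h' := congrArg Fin.val h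
  simp only [Fin.revPerm_apply, Fin.val_rev] at h'
  omega

lemma conj_mem_matchings {N : ℕ} (σ : Equiv.Perm (Fin N)) {M : Equiv.Perm (Fin N)}
    (hM : M ∈ matchings N) : σ * M * σ⁻¹ ∈ matchings N := by
  rw [mem_matchings] at hM ⊢
  intro s
  refine ⟨by simp [(hM _).1], fun h => (hM (σ⁻¹ s)).2 ?_⟩
  simp only [Equiv.Perm.mul_apply] at h
  exact (Equiv.Perm.eq_inv_iff_eq.2 h)

/-- Counts of matchings with a prescribed property are invariant under conjugation. -/
lemma card_matchings_conj {N : ℕ} (σ : Equiv.Perm (Fin N)) (P Q : Equiv.Perm (Fin N) → Prop)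
    [DecidablePred P] [DecidablePred Q]
    (hPQ : ∀ M, P M → Q (σ * M * σ⁻¹)) (hQP : ∀ M, Q M → P (σ⁻¹ * M * σ)) :
    ((matchings N).filter P).card = ((matchings N).filter Q).card := by
  refine Finset.card_bij' (fun M _ => σ * M * σ⁻¹) (fun M _ => σ⁻¹ * M * σ) ?_ ?_ ?_ ?_
  · intro M hM
    rw [Finset.mem_filter] at hM ⊢
    exact ⟨conj_mem_matchings σ hM.1, hPQ M hM.2⟩
  · intro M hM
    rw [Finset.mem_filter] at hM ⊢
    refine ⟨?_, hQP M hM.2⟩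
    simpa using conj_mem_matchings σ⁻¹ hM.1
  · intro M _
    group
  · intro M _
    group

lemma card_matchings_one {N : ℕ} (s t t' : Fin N) (ht : t ≠ s) (ht' : t' ≠ s) :
    ((matchings N).filter fun M => M s = t).card =
      ((matchings N).filter fun M => M s = t').card := by
  have hs : Equiv.swap t t' s = s := Equiv.swap_apply_of_ne_of_ne ht.symm ht'.symm
  refine card_matchings_conj (Equiv.swap t t') _ _ ?_ ?_ <;> intro M hM <;>
    simp [hs, hM]

lemma card_matchings_two {N : ℕ} (s t s' t₁ t₂ : Fin N) (hs : s ≠ t₁) (hs' : s ≠ t₂)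
    (ht : t ≠ t₁) (ht' : t ≠ t₂) (h₁ : s' ≠ t₁) (h₂ : s' ≠ t₂) :
    ((matchings N).filter fun M => M s = t ∧ M s' = t₁).card =
      ((matchings N).filter fun M => M s = t ∧ M s' = t₂).card := by
  have e1 : Equiv.swap t₁ t₂ s = s := Equiv.swap_apply_of_ne_of_ne hs hs'
  have e2 : Equiv.swap t₁ t₂ t = t := Equiv.swap_apply_of_ne_of_ne ht ht'
  have e3 : Equiv.swap t₁ t₂ s' = s' := Equiv.swap_apply_of_ne_of_ne h₁ h₂
  refine card_matchings_conj (Equiv.swap t₁ t₂) _ _ ?_ ?_ <;> rintro M ⟨hM, hM'⟩ <;>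
    simp [e1, e2, e3, hM, hM']

lemma card_matchings_one_mul {N : ℕ} (s t : Fin N) (ht : t ≠ s) :
    (N - 1) * ((matchings N).filter fun M => M s = t).card = (matchings N).card := by
  have hmaps : ∀ M ∈ matchings N, M s ∈ Finset.univ.erase s := fun M hM => by
    simpa using (mem_matchings.1 hM s).2
  rw [Finset.card_eq_sum_card_fiberwise hmaps,
    Finset.sum_congr rfl fun t' ht' => card_matchings_one s t' t (Finset.ne_of_mem_erase ht') ht]
  simp

lemma card_matchings_two_mul {N : ℕ} (s t s' t' : Fin N) (hst : t ≠ s) (hs : s' ≠ s)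
    (hs't : s' ≠ t) (h1 : t' ≠ s) (h2 : t' ≠ t) (h3 : t' ≠ s') :
    (N - 3) * ((matchings N).filter fun M => M s = t ∧ M s' = t').card =
      ((matchings N).filter fun M => M s = t).card := by
  have hmaps : ∀ M ∈ (matchings N).filter (fun M => M s = t),
      M s' ∈ ((Finset.univ.erase s).erase t).erase s' := fun M hM => by
    rw [Finset.mem_filter] at hM
    have hM' := mem_matchings.1 hM.1
    simp only [Finset.mem_erase, Finset.mem_univ, and_true]
    refine ⟨(hM' s').2, fun h => ?_, fun h => ?_⟩
    · exact hs (M.injective (h.trans hM.2.symm))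
    · apply hs't
      rw [← (hM' s').1, h, hM.2]
  have hcongr : ∀ x ∈ ((Finset.univ.erase s).erase t).erase s',
      (((matchings N).filter (fun M => M s = t)).filter fun M => M s' = x).card =
        ((matchings N).filter fun M => M s = t ∧ M s' = t').card := by
    intro x hx
    simp only [Finset.mem_erase, Finset.mem_univ, and_true] at hx
    rw [Finset.filter_filter]
    exact card_matchings_two s t s' x t' hx.2.2.symm h1.symm hx.2.1.symm h2.symm hx.1.symm h3.symm
  rw [Finset.card_eq_sum_card_fiberwise hmaps, Finset.sum_congr rfl hcongr, Finset.sum_const,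
    Finset.card_erase_of_mem (by simp [hs, hs't]), Finset.card_erase_of_mem (by simp [hst]),
    Finset.card_erase_of_mem (by simp)]
  simp [Nat.sub_sub]

lemma matchAvg_indicator {N : ℕ} (P : Equiv.Perm (Fin N) → Prop) [DecidablePred P] :
    matchAvg (fun M => if P M then (1 : ℝ) else 0) =
      (((matchings N).filter P).card : ℝ) / ((matchings N).card : ℝ) := by
  simp [matchAvg]

lemma matchAvg_one {m : ℕ} (s t : Fin (2 * m)) (ht : t ≠ s) :
    matchAvg (fun M => if M s = t then (1 : ℝ) else 0) = 1 / (((2 * m : ℕ) : ℝ) - 1) := by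
  have h0 : (0 : ℝ) < ((matchings (2 * m)).card : ℝ) := by exact_mod_cast matchings_card_pos m
  have h := card_matchings_one_mul s t ht
  have hN : 1 < 2 * m := by have := s.2; omega
  have hN' : (1 : ℝ) < ((2 * m : ℕ) : ℝ) := by exact_mod_cast hN
  have h' : (((2 * m : ℕ) : ℝ) - 1) *
      (((matchings (2 * m)).filter fun M => M s = t).card : ℝ) = (matchings (2 * m)).card := by
    rw [← h]; push_cast [Nat.cast_sub hN.le]; ring
  rw [matchAvg_indicator, div_eq_div_iff h0.ne' (by linarith), ← h']
  ring

lemma matchAvg_two {m : ℕ} (s t s' t' : Fin (2 * m)) (hst : t ≠ s) (hs : s' ≠ s)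
    (hs't : s' ≠ t) (h1 : t' ≠ s) (h2 : t' ≠ t) (h3 : t' ≠ s') :
    matchAvg (fun M => if M s = t ∧ M s' = t' then (1 : ℝ) else 0) =
      1 / ((((2 * m : ℕ) : ℝ) - 1) * (((2 * m : ℕ) : ℝ) - 3)) := by
  have h0 : (0 : ℝ) < ((matchings (2 * m)).card : ℝ) := by exact_mod_cast matchings_card_pos m
  have ha := card_matchings_one_mul s t hst
  have hb := card_matchings_two_mul s t s' t' hst hs hs't h1 h2 h3
  have hN : 3 < 2 * m := by
    have : ({s, t, s', t'} : Finset (Fin (2 * m))).card = 4 := by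
      rw [Finset.card_insert_of_notMem, Finset.card_insert_of_notMem,
        Finset.card_insert_of_notMem, Finset.card_singleton] <;>
        simp [hst.symm, hs.symm, h1.symm, hs't.symm, h2.symm, h3.symm]
    have h := Finset.card_le_univ ({s, t, s', t'} : Finset (Fin (2 * m)))
    rw [this, Fintype.card_fin] at h
    omega
  have hN' : (3 : ℝ) < ((2 * m : ℕ) : ℝ) := by exact_mod_cast hN
  have h' : (((2 * m : ℕ) : ℝ) - 1) * ((((2 * m : ℕ) : ℝ) - 3) *
      (((matchings (2 * m)).filter fun M => M s = t ∧ M s' = t').card : ℝ)) =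
      (matchings (2 * m)).card := by
    rw [← ha, ← hb]; push_cast [Nat.cast_sub hN.le, Nat.cast_sub (show 1 ≤ 2 * m by omega)]; ring
  rw [matchAvg_indicator, div_eq_div_iff h0.ne' (by nlinarith), ← h']
  ring

lemma matchAvg_mono {N : ℕ} {F G : Equiv.Perm (Fin N) → ℝ}
    (h : ∀ M ∈ matchings N, F M ≤ G M) : matchAvg F ≤ matchAvg G :=
  div_le_div_of_nonneg_right (Finset.sum_le_sum h) (by positivity)

lemma matchAvg_congr {N : ℕ} {F G : Equiv.Perm (Fin N) → ℝ}
    (h : ∀ M ∈ matchings N, F M = G M) : matchAvg F = matchAvg G := by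
  rw [matchAvg, Finset.sum_congr rfl h, matchAvg]

lemma matchAvg_add {N : ℕ} (F G : Equiv.Perm (Fin N) → ℝ) :
    matchAvg (fun M => F M + G M) = matchAvg F + matchAvg G := by
  simp [matchAvg, Finset.sum_add_distrib, add_div]

lemma matchAvg_sub {N : ℕ} (F G : Equiv.Perm (Fin N) → ℝ) :
    matchAvg (fun M => F M - G M) = matchAvg F - matchAvg G := by
  simp [matchAvg, Finset.sum_sub_distrib, sub_div]

lemma matchAvg_mul_left {N : ℕ} (c : ℝ) (F : Equiv.Perm (Fin N) → ℝ) :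
    matchAvg (fun M => c * F M) = c * matchAvg F := by
  simp [matchAvg, ← Finset.mul_sum, mul_div_assoc]

lemma matchAvg_const (m : ℕ) (c : ℝ) :
    matchAvg (fun _ : Equiv.Perm (Fin (2 * m)) => c) = c := by
  have h0 : (0 : ℝ) < ((matchings (2 * m)).card : ℝ) := by exact_mod_cast matchings_card_pos m
  simp [matchAvg]
  field_simp

lemma matchAvg_sum {N : ℕ} {ι : Type*} (S : Finset ι) (F : ι → Equiv.Perm (Fin N) → ℝ) :
    matchAvg (fun M => ∑ i ∈ S, F i M) = ∑ i ∈ S, matchAvg (F i) := by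
  simp only [matchAvg]
  rw [Finset.sum_comm, Finset.sum_div]

lemma matchAvg_nonneg {N : ℕ} {F : Equiv.Perm (Fin N) → ℝ}
    (h : ∀ M ∈ matchings N, 0 ≤ F M) : 0 ≤ matchAvg F :=
  div_nonneg (Finset.sum_nonneg h) (by positivity)

lemma abs_matchAvg_le {N : ℕ} (F : Equiv.Perm (Fin N) → ℝ) :
    |matchAvg F| ≤ matchAvg fun M => |F M| := by
  rw [matchAvg, abs_div, Nat.abs_cast]
  exact div_le_div_of_nonneg_right (Finset.abs_sum_le_sum_abs _ _) (by positivity)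

/-- The mean number of stubs in `A` matched into a disjoint set `B`. -/
lemma matchAvg_card_edges {m : ℕ} (A B : Finset (Fin (2 * m))) (h : ∀ s ∈ A, s ∉ B) :
    matchAvg (fun M => ((A.filter fun s => M s ∈ B).card : ℝ)) =
      A.card * B.card / (((2 * m : ℕ) : ℝ) - 1) := by
  have e : ∀ M : Equiv.Perm (Fin (2 * m)), ((A.filter fun s => M s ∈ B).card : ℝ) =
      ∑ s ∈ A, ∑ t ∈ B, if M s = t then (1 : ℝ) else 0 := by
    intro M
    simp [Finset.sum_ite_eq]
  simp only [e, matchAvg_sum]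
  rw [Finset.sum_congr rfl fun s hs => Finset.sum_congr rfl fun t ht =>
    matchAvg_one s t (fun hts => h s hs (hts ▸ ht))]
  simp
  ring

/-- The mean number of stubs in `A` matched inside `A` is at most `|A|² / (N - 1)`. -/
lemma matchAvg_card_loops_le {m : ℕ} (A : Finset (Fin (2 * m))) (hm : 1 ≤ m) :
    matchAvg (fun M => ((A.filter fun s => M s ∈ A).card : ℝ)) ≤
      A.card * A.card / (((2 * m : ℕ) : ℝ) - 1) := by
  have e : ∀ M ∈ matchings (2 * m), ((A.filter fun s => M s ∈ A).card : ℝ) =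
      ∑ s ∈ A, ∑ t ∈ A.erase s, if M s = t then (1 : ℝ) else 0 := by
    intro M hM
    have := mem_matchings.1 hM
    simp [Finset.sum_ite_eq, (this _).2]
  have hpos : (0 : ℝ) < ((2 * m : ℕ) : ℝ) - 1 := by
    have : (1 : ℝ) ≤ m := by exact_mod_cast hm
    push_cast; linarith
  rw [matchAvg_congr e]
  simp only [matchAvg_sum]
  rw [Finset.sum_congr rfl fun s hs => Finset.sum_congr rfl fun t ht =>
    matchAvg_one s t (Finset.ne_of_mem_erase ht)]
  have : ∀ s ∈ A, ∑ t ∈ A.erase s, 1 / (((2 * m : ℕ) : ℝ) - 1) ≤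
      A.card * (1 / (((2 * m : ℕ) : ℝ) - 1)) := by
    intro s hs
    rw [Finset.sum_const, nsmul_eq_mul]
    gcongr
    exact Finset.erase_subset _ _
  refine (Finset.sum_le_sum this).trans (le_of_eq ?_)
  simp
  ring

lemma card_offDiag_cast {α : Type*} (A : Finset α) :
    (A.offDiag.card : ℝ) = A.card * (A.card - 1) := by
  rw [Finset.offDiag_card, Nat.cast_sub (Nat.le_mul_self _)]
  push_cast; ring

/-- The mean number of ordered pairs of stubs of `A` matched to a pair in `R`. -/
lemma matchAvg_card_pairs {m : ℕ} (A : Finset (Fin (2 * m)))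
    (R : Finset (Fin (2 * m) × Fin (2 * m)))
    (hR : ∀ p ∈ R, p.1 ∉ A ∧ p.2 ∉ A ∧ p.1 ≠ p.2) :
    matchAvg (fun M => ((A.offDiag.filter fun q => (M q.1, M q.2) ∈ R).card : ℝ)) =
      A.card * (A.card - 1) * R.card /
        ((((2 * m : ℕ) : ℝ) - 1) * (((2 * m : ℕ) : ℝ) - 3)) := by
  have e : ∀ M : Equiv.Perm (Fin (2 * m)),
      ((A.offDiag.filter fun q => (M q.1, M q.2) ∈ R).card : ℝ) =
      ∑ q ∈ A.offDiag, ∑ p ∈ R, if M q.1 = p.1 ∧ M q.2 = p.2 then (1 : ℝ) else 0 := by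
    intro M
    simp only [← Prod.mk_inj, Prod.mk.eta]
    simp [Finset.sum_ite_eq]
  simp only [e, matchAvg_sum]
  have e2 : ∀ q ∈ A.offDiag, ∀ p ∈ R,
      matchAvg (fun M => if M q.1 = p.1 ∧ M q.2 = p.2 then (1 : ℝ) else 0) =
      1 / ((((2 * m : ℕ) : ℝ) - 1) * (((2 * m : ℕ) : ℝ) - 3)) := by
    intro q hq p hp
    obtain ⟨h1, h2, h12⟩ := Finset.mem_offDiag.1 hq
    obtain ⟨g1, g2, g12⟩ := hR p hp
    exact matchAvg_two _ _ _ _ (fun h => g1 (h ▸ h1)) h12.symm (fun h => g1 (h ▸ h2))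
      (fun h => g2 (h ▸ h1)) g12.symm (fun h => g2 (h ▸ h2))
  rw [Finset.sum_congr rfl fun q hq => Finset.sum_congr rfl fun p hp => e2 q hq p hp]
  simp only [Finset.sum_const, nsmul_eq_mul, card_offDiag_cast]
  ring

/-- The second factorial moment of the number of stubs in `A` matched into a disjoint set `B`. -/
lemma matchAvg_factorial_two {m : ℕ} (A B : Finset (Fin (2 * m))) (h : ∀ s ∈ A, s ∉ B) :
    matchAvg (fun M => ((A.filter fun s => M s ∈ B).card : ℝ) *
        (((A.filter fun s => M s ∈ B).card : ℝ) - 1)) =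
      A.card * (A.card - 1) * (B.card * (B.card - 1)) /
        ((((2 * m : ℕ) : ℝ) - 1) * (((2 * m : ℕ) : ℝ) - 3)) := by
  rw [← card_offDiag_cast B, ← matchAvg_card_pairs A B.offDiag]
  · congr 1
    ext M
    rw [← card_offDiag_cast]
    congr 2
    ext q
    simp only [Finset.mem_offDiag, Finset.mem_filter, ne_eq, EmbeddingLike.apply_eq_iff_eq]
    tauto
  · intro p hp
    obtain ⟨h1, h2, h12⟩ := Finset.mem_offDiag.1 hp
    exact ⟨fun h' => h _ h' h1, fun h' => h _ h' h2, h12⟩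

/-- The stubs of the vertex `v`. -/
def stubs {n N : ℕ} (φ : Fin N → Fin n) (v : Fin n) : Finset (Fin N) :=
  Finset.univ.filter fun s => φ s = v

/-- The neighbours of `v` in the erased graph. -/
def nbrs {n N : ℕ} (φ : Fin N → Fin n) (M : Equiv.Perm (Fin N)) (v : Fin n) : Finset (Fin n) :=
  Finset.univ.filter fun w => ecmAdj φ M v w

/-- The number of edges in the bucket of `v`, as a natural number. -/
def bucketCard {n N : ℕ} (φ : Fin N → Fin n) (M : Equiv.Perm (Fin N)) (v : Fin n) : ℕ :=
  ((nbrs φ M v).filter fun w => ecmDeg φ M v ≤ ecmDeg φ M w).card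

/-- The stubs owned by vertices other than `v` which satisfy `P`. -/
def farStubs {n N : ℕ} (φ : Fin N → Fin n) (v : Fin n) (P : Fin n → Prop) : Finset (Fin N) :=
  Finset.univ.filter fun t => φ t ≠ v ∧ P (φ t)

/-- The number of stubs of `v` matched to a stub of another vertex satisfying `P`. -/
def farCount {n N : ℕ} (φ : Fin N → Fin n) (M : Equiv.Perm (Fin N)) (v : Fin n)
    (P : Fin n → Prop) : ℕ :=
  ((stubs φ v).filter fun s => M s ∈ farStubs φ v P).card

/-- Ordered pairs of distinct stubs owned by a common vertex, other than `v`, satisfying `P`. -/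
def twinPairs {n N : ℕ} (φ : Fin N → Fin n) (v : Fin n) (P : Fin n → Prop) :
    Finset (Fin N × Fin N) :=
  Finset.univ.filter fun p => p.1 ≠ p.2 ∧ φ p.1 = φ p.2 ∧ φ p.1 ≠ v ∧ P (φ p.1)

/-- The number of ordered pairs of stubs of `v` matched to a common vertex satisfying `P`. -/
def collCount {n N : ℕ} (φ : Fin N → Fin n) (M : Equiv.Perm (Fin N)) (v : Fin n)
    (P : Fin n → Prop) : ℕ :=
  ((stubs φ v).offDiag.filter fun q => (M q.1, M q.2) ∈ twinPairs φ v P).card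

section Graph

variable {n N : ℕ} {φ : Fin N → Fin n} {M : Equiv.Perm (Fin N)} {d : Fin n → ℕ}

lemma mem_stubs {v : Fin n} {s : Fin N} : s ∈ stubs φ v ↔ φ s = v := by simp [stubs]

lemma mem_farStubs {v : Fin n} {P : Fin n → Prop} {t : Fin N} :
    t ∈ farStubs φ v P ↔ φ t ≠ v ∧ P (φ t) := by simp [farStubs]

lemma ecmAdj_symm (hM : M ∈ matchings N) {u v : Fin n} (h : ecmAdj φ M u v) :
    ecmAdj φ M v u := by
  obtain ⟨huv, s, hs, hs'⟩ := h
  exact ⟨huv.symm, M s, hs', by rw [(mem_matchings.1 hM s).1, hs]⟩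

lemma mem_nbrs {v w : Fin n} : w ∈ nbrs φ M v ↔ v ≠ w ∧ ∃ s, φ s = v ∧ φ (M s) = w := by
  simp only [nbrs, Finset.mem_filter, Finset.mem_univ, true_and]
  rfl

lemma nbrs_eq (v : Fin n) :
    nbrs φ M v = ((stubs φ v).image fun s => φ (M s)).erase v := by
  ext w
  simp only [mem_nbrs, Finset.mem_erase, Finset.mem_image, mem_stubs, ne_comm]

lemma ecmDeg_eq_card_nbrs (hM : M ∈ matchings N) (v : Fin n) :
    ecmDeg φ M v = (nbrs φ M v).card := by
  rw [ecmDeg, nbrs]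
  congr 1
  ext w
  simp only [Finset.mem_filter, Finset.mem_univ, true_and]
  exact ⟨ecmAdj_symm hM, ecmAdj_symm hM⟩

lemma ecmX₂_eq (v : Fin n) : ecmX₂ φ M v = bucketCard φ M v := by
  rw [ecmX₂, Finset.sum_boole, bucketCard, nbrs, Finset.filter_filter]
  congr 2
  ext w
  simp only [Finset.mem_filter, Finset.mem_univ, true_and]
  rfl

lemma ecmDeg_le_card_stubs (hM : M ∈ matchings N) (v : Fin n) :
    ecmDeg φ M v ≤ (stubs φ v).card := by
  rw [ecmDeg_eq_card_nbrs hM, nbrs_eq]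
  exact (Finset.card_erase_le).trans Finset.card_image_le

lemma card_stubs_le (hφ : IsAlmostStubMap d φ) (v : Fin n) : (stubs φ v).card ≤ d v := hφ.1 v

lemma le_card_stubs_add_one (hφ : IsAlmostStubMap d φ) (v : Fin n) :
    d v ≤ (stubs φ v).card + 1 := by
  have h := Finset.single_le_sum (f := fun v => d v - (stubs φ v).card)
    (fun i _ => Nat.zero_le _) (Finset.mem_univ v)
  have h' : d v - (stubs φ v).card ≤ 1 := h.trans hφ.2
  omega

lemma sum_card_stubs : ∑ v, (stubs φ v).card = N := by
  have := Finset.card_eq_sum_card_fiberwise (s := (Finset.univ : Finset (Fin N)))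
    (t := Finset.univ) (f := φ) (fun _ _ => by simp)
  simpa [stubs] using this.symm

lemma card_defective_le_one (hφ : IsAlmostStubMap d φ) :
    (Finset.univ.filter fun v => (stubs φ v).card ≠ d v).card ≤ 1 := by
  rw [Finset.card_filter]
  refine (Finset.sum_le_sum fun v _ => ?_).trans hφ.2
  have := card_stubs_le hφ v
  change _ ≤ d v - (stubs φ v).card
  split_ifs <;> omega

lemma ecmDeg_le (hφ : IsAlmostStubMap d φ) (hM : M ∈ matchings N) (v : Fin n) :
    ecmDeg φ M v ≤ d v :=
  (ecmDeg_le_card_stubs hM v).trans (card_stubs_le hφ v)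

lemma bucketCard_le_ecmDeg (hM : M ∈ matchings N) (v : Fin n) :
    bucketCard φ M v ≤ ecmDeg φ M v := by
  rw [ecmDeg_eq_card_nbrs hM]
  exact Finset.card_filter_le _ _

lemma bucketCard_le (hφ : IsAlmostStubMap d φ) (hM : M ∈ matchings N) (v : Fin n) :
    bucketCard φ M v ≤ d v :=
  (bucketCard_le_ecmDeg hM v).trans (ecmDeg_le hφ hM v)

lemma farCount_le (hφ : IsAlmostStubMap d φ) (v : Fin n) (P : Fin n → Prop) :
    farCount φ M v P ≤ d v :=
  (Finset.card_filter_le _ _).trans (card_stubs_le hφ v)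

/-- A vertex whose degree survives the erasure has no loops and no multiple edges. -/
lemma injOn_of_ecmDeg_eq (hφ : IsAlmostStubMap d φ) (hM : M ∈ matchings N) {v : Fin n}
    (h : ecmDeg φ M v = d v) :
    Set.InjOn (fun s => φ (M s)) (stubs φ v) ∧ ∀ s ∈ stubs φ v, φ (M s) ≠ v := by
  have h1 := card_stubs_le hφ v
  rw [ecmDeg_eq_card_nbrs hM, nbrs_eq] at h
  have h2 : ((stubs φ v).image fun s => φ (M s)).card ≤ (stubs φ v).card := Finset.card_image_le
  refine ⟨Finset.card_image_iff.1 ?_, fun s hs hsv => ?_⟩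
  · have := Finset.card_erase_le (s := (stubs φ v).image fun s => φ (M s)) (a := v)
    omega
  · have hmem : v ∈ (stubs φ v).image fun s => φ (M s) := Finset.mem_image.2 ⟨s, hs, hsv⟩
    have := Finset.card_erase_lt_of_mem hmem
    omega

lemma bucketCard_eq_farCount (hφ : IsAlmostStubMap d φ) (hM : M ∈ matchings N) {v : Fin n}
    (h : ecmDeg φ M v = d v) (hw : ∀ w ∈ nbrs φ M v, ecmDeg φ M w = d w) :
    bucketCard φ M v = farCount φ M v fun u => d v ≤ d u := by
  obtain ⟨hinj, hne⟩ := injOn_of_ecmDeg_eq hφ hM h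
  rw [bucketCard, farCount, ← Finset.card_image_of_injOn (f := fun s => φ (M s))
    (s := (stubs φ v).filter fun s => M s ∈ farStubs φ v fun u => d v ≤ d u)
    (hinj.mono (by exact_mod_cast Finset.filter_subset _ _))]
  congr 1
  ext w
  simp only [Finset.mem_filter, Finset.mem_image, mem_farStubs, mem_stubs]
  constructor
  · rintro ⟨hwv, hle⟩
    rw [hw w hwv, h] at hle
    obtain ⟨hvw, s, hs, rfl⟩ := mem_nbrs.1 hwv
    exact ⟨s, ⟨hs, hvw.symm, hle⟩, rfl⟩
  · rintro ⟨s, ⟨hs, hsv, hle⟩, rfl⟩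
    have hmem : φ (M s) ∈ nbrs φ M v := mem_nbrs.2 ⟨hsv.symm, s, hs, rfl⟩
    exact ⟨hmem, by rw [hw _ hmem, h]; exact hle⟩

/-- The vertices of prescribed degree at most `J` that lose degree in the erasure. -/
def lossy (d : Fin n → ℕ) (φ : Fin N → Fin n) (M : Equiv.Perm (Fin N)) (J : ℕ) :
    Finset (Fin n) :=
  Finset.univ.filter fun w => d w ≤ J ∧ ecmDeg φ M w ≠ d w

lemma card_bucketCard_ne_farCount_le (hφ : IsAlmostStubMap d φ) (hM : M ∈ matchings N)
    {K J : ℕ} (hKJ : K ≤ J) :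
    (Finset.univ.filter fun v => d v ≤ K ∧
        bucketCard φ M v ≠ farCount φ M v fun u => d v ≤ d u).card ≤
      (1 + J) * (lossy d φ M J).card + ∑ w ∈ Finset.univ.filter (fun w => J < d w), d w := by
  have hsub : (Finset.univ.filter fun v => d v ≤ K ∧
      bucketCard φ M v ≠ farCount φ M v fun u => d v ≤ d u) ⊆
      lossy d φ M J ∪ ((lossy d φ M J).biUnion (nbrs φ M) ∪
        (Finset.univ.filter (fun w => J < d w)).biUnion (nbrs φ M)) := by
    intro v hv
    simp only [Finset.mem_filter, Finset.mem_univ, true_and] at hv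
    by_contra hnot
    simp only [Finset.mem_union, Finset.mem_biUnion, lossy, Finset.mem_filter, Finset.mem_univ,
      true_and, not_or, not_exists, not_and, not_not] at hnot
    refine hv.2 (bucketCard_eq_farCount hφ hM (hnot.1 (hv.1.trans hKJ)) fun w hw => ?_)
    have hw' : v ∈ nbrs φ M w := by
      simp only [nbrs, Finset.mem_filter, Finset.mem_univ, true_and] at hw ⊢
      exact ecmAdj_symm hM hw
    by_contra hne
    by_cases hJ : d w ≤ J
    · exact hnot.2.1 w ⟨hJ, hne⟩ hw'
    · exact hnot.2.2 w (not_le.1 hJ) hw'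
  have hn : ∀ w, (nbrs φ M w).card ≤ d w := fun w => by
    rw [← ecmDeg_eq_card_nbrs hM]; exact ecmDeg_le hφ hM w
  refine (Finset.card_le_card hsub).trans ((Finset.card_union_le _ _).trans ?_)
  have h1 : ((lossy d φ M J).biUnion (nbrs φ M)).card ≤ J * (lossy d φ M J).card := by
    rw [mul_comm]
    refine Finset.card_biUnion_le_card_mul _ _ _ fun w hw => (hn w).trans ?_
    simp only [lossy, Finset.mem_filter] at hw
    exact hw.2.1
  have h2 : ((Finset.univ.filter (fun w => J < d w)).biUnion (nbrs φ M)).card ≤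
      ∑ w ∈ Finset.univ.filter (fun w => J < d w), d w :=
    Finset.card_biUnion_le.trans (Finset.sum_le_sum fun w _ => hn w)
  have h3 := Finset.card_union_le ((lossy d φ M J).biUnion (nbrs φ M))
    ((Finset.univ.filter (fun w => J < d w)).biUnion (nbrs φ M))
  linarith

/-- A set is at most as large as an image plus the number of ordered colliding pairs. -/
lemma card_le_card_image_add {α β : Type*} [DecidableEq β] (A : Finset α) (g : α → β) :
    A.card ≤ (A.image g).card + (A.offDiag.filter fun q => g q.1 = g q.2).card := by
  set C := (A.offDiag.filter fun q => g q.1 = g q.2) with hC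
  have h1 : (A \ C.image Prod.fst).card ≤ (A.image g).card := by
    refine Finset.card_le_card_of_injOn g (fun a ha => ?_) fun a ha b hb hab => ?_
    · exact Finset.mem_coe.2
        (Finset.mem_image_of_mem g (Finset.mem_sdiff.1 (Finset.mem_coe.1 ha)).1)
    · have ha' := Finset.mem_sdiff.1 (Finset.mem_coe.1 ha)
      have hb' := Finset.mem_sdiff.1 (Finset.mem_coe.1 hb)
      by_contra hne
      refine ha'.2 (Finset.mem_image.2 ⟨(a, b), ?_, rfl⟩)
      rw [hC, Finset.mem_filter, Finset.mem_offDiag]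
      exact ⟨⟨ha'.1, hb'.1, hne⟩, hab⟩
  have h2 : (C.image Prod.fst).card ≤ C.card := Finset.card_image_le
  have h3 := Finset.card_le_card_sdiff_add_card (s := A) (t := C.image Prod.fst)
  omega

lemma farCount_le_ecmDeg_add (hM : M ∈ matchings N) (v : Fin n) (P : Fin n → Prop) :
    farCount φ M v P ≤ ecmDeg φ M v + collCount φ M v P := by
  set A := (stubs φ v).filter fun s => M s ∈ farStubs φ v P with hA
  have h := card_le_card_image_add A fun s => φ (M s)
  have h1 : (A.image fun s => φ (M s)).card ≤ ecmDeg φ M v := by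
    rw [ecmDeg_eq_card_nbrs hM]
    refine Finset.card_le_card fun w hw => ?_
    obtain ⟨s, hs, rfl⟩ := Finset.mem_image.1 hw
    rw [hA, Finset.mem_filter, mem_stubs, mem_farStubs] at hs
    exact mem_nbrs.2 ⟨hs.2.1.symm, s, hs.1, rfl⟩
  have h2 : (A.offDiag.filter fun q => φ (M q.1) = φ (M q.2)).card ≤ collCount φ M v P := by
    refine Finset.card_le_card fun q hq => ?_
    simp only [hA, twinPairs, Finset.mem_filter, Finset.mem_offDiag, mem_stubs, mem_farStubs,
      Finset.mem_univ, true_and, ne_eq, EmbeddingLike.apply_eq_iff_eq] at hq ⊢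
    tauto
  exact h.trans (add_le_add h1 h2)

/-- A vertex losing degree has a discarded stub, a loop or a multiple edge. -/
lemma lossy_cases (hM : M ∈ matchings N) {v : Fin n} (h : ecmDeg φ M v ≠ d v) :
    (stubs φ v).card ≠ d v ∨ 0 < ((stubs φ v).filter fun s => M s ∈ stubs φ v).card ∨
      0 < collCount φ M v fun _ => True := by
  by_contra! hcon
  obtain ⟨h1, h2, h3⟩ := hcon
  have hloop : ∀ s ∈ stubs φ v, φ (M s) ≠ v := fun s hs hsv => by
    have hmem : s ∈ (stubs φ v).filter fun s => M s ∈ stubs φ v :=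
      Finset.mem_filter.2 ⟨hs, mem_stubs.2 hsv⟩
    have := Finset.card_pos.2 ⟨s, hmem⟩
    omega
  have h4 := farCount_le_ecmDeg_add (φ := φ) hM v fun _ => True
  have h5 : farCount φ M v (fun _ => True) = (stubs φ v).card := by
    rw [farCount, Finset.filter_true_of_mem]
    intro s hs
    exact mem_farStubs.2 ⟨hloop s hs, trivial⟩
  have h6 := ecmDeg_le_card_stubs (φ := φ) hM v
  omega

lemma bucketCard_le_farCount (hφ : IsAlmostStubMap d φ) (hM : M ∈ matchings N) {v : Fin n}
    (h : d v ≤ 2 * ecmDeg φ M v) :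
    bucketCard φ M v ≤ farCount φ M v fun u => d v ≤ 2 * d u := by
  rw [farCount]
  refine le_trans (Finset.card_le_card fun w hw => ?_) (Finset.card_image_le
    (f := fun s => φ (M s)))
  obtain ⟨hw1, hw2⟩ := Finset.mem_filter.1 hw
  obtain ⟨hvw, s, hs, rfl⟩ := mem_nbrs.1 hw1
  have := ecmDeg_le hφ hM (φ (M s))
  refine Finset.mem_image.2 ⟨s, Finset.mem_filter.2 ⟨mem_stubs.2 hs, mem_farStubs.2
    ⟨hvw.symm, by omega⟩⟩, rfl⟩

lemma card_farStubs (v : Fin n) (P : Fin n → Prop) :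
    (farStubs φ v P).card = ∑ u ∈ Finset.univ.filter (fun u => u ≠ v ∧ P u), (stubs φ u).card := by
  rw [Finset.card_eq_sum_card_fiberwise (f := φ)
    (t := Finset.univ.filter (fun u => u ≠ v ∧ P u))]
  · refine Finset.sum_congr rfl fun u hu => ?_
    congr 1
    ext s
    simp only [Finset.mem_filter, mem_farStubs, mem_stubs, Finset.mem_univ, true_and] at hu ⊢
    constructor
    · exact fun h => h.2
    · rintro rfl
      exact ⟨hu, rfl⟩
  · intro s hs
    have := mem_farStubs.1 hs
    simpa using this

lemma card_farStubs_add_le (v : Fin n) (P : Fin n → Prop) :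
    (farStubs φ v P).card + (stubs φ v).card ≤ N := by
  rw [← Finset.card_union_of_disjoint]
  · simpa using Finset.card_le_univ (farStubs φ v P ∪ stubs φ v)
  · rw [Finset.disjoint_left]
    intro s hs hs'
    exact (mem_farStubs.1 hs).1 (mem_stubs.1 hs')

lemma card_twinPairs_le (hφ : IsAlmostStubMap d φ) (v : Fin n) (P : Fin n → Prop) {B : ℕ}
    (hB : ∀ u, P u → d u ≤ B) : (twinPairs φ v P).card ≤ N * B := by
  have h := Finset.card_le_mul_card_image_of_maps_to (s := twinPairs φ v P)
    (t := (Finset.univ : Finset (Fin N))) (f := Prod.fst) (fun _ _ => Finset.mem_univ _) B ?_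
  · simpa [mul_comm] using h
  · intro t _
    by_cases hP : P (φ t)
    · refine le_trans ?_ ((card_stubs_le hφ (φ t)).trans (hB _ hP))
      refine Finset.card_le_card_of_injOn Prod.snd (fun p hp => ?_) fun p hp q hq hpq => ?_
      · simp only [Finset.coe_filter, Set.mem_ofPred_eq, twinPairs, Finset.mem_filter,
          Finset.mem_univ, true_and] at hp
        rw [Finset.mem_coe, mem_stubs, ← hp.2, hp.1.2.1]
      · simp only [Finset.coe_filter, Set.mem_ofPred_eq] at hp hq
        exact Prod.ext (hp.2.trans hq.2.symm) hpq
    · rw [Finset.card_eq_zero.2]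
      · exact Nat.zero_le _
      · rw [Finset.filter_eq_empty_iff]
        rintro p hp rfl
        simp only [twinPairs, Finset.mem_filter, Finset.mem_univ, true_and] at hp
        exact hP hp.2.2.2

end Graph

section FixedStubs

variable {n m : ℕ} {φ : Fin (2 * m) → Fin n} {d : Fin n → ℕ}

lemma matchAvg_collCount (v : Fin n) (P : Fin n → Prop) :
    matchAvg (fun M => (collCount φ M v P : ℝ)) =
      (stubs φ v).card * ((stubs φ v).card - 1) * (twinPairs φ v P).card /
        ((((2 * m : ℕ) : ℝ) - 1) * (((2 * m : ℕ) : ℝ) - 3)) := by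
  refine matchAvg_card_pairs _ _ fun p hp => ?_
  simp only [twinPairs, Finset.mem_filter, Finset.mem_univ, true_and] at hp
  rw [mem_stubs, mem_stubs]
  exact ⟨hp.2.2.1, hp.2.1 ▸ hp.2.2.1, hp.1⟩

lemma matchAvg_farCount (v : Fin n) (P : Fin n → Prop) :
    matchAvg (fun M => (farCount φ M v P : ℝ)) =
      (stubs φ v).card * (farStubs φ v P).card / (((2 * m : ℕ) : ℝ) - 1) :=
  matchAvg_card_edges _ _ fun _ hs hs' => (mem_farStubs.1 hs').1 (mem_stubs.1 hs)

lemma matchAvg_farCount_two (v : Fin n) (P : Fin n → Prop) :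
    matchAvg (fun M => (farCount φ M v P : ℝ) * ((farCount φ M v P : ℝ) - 1)) =
      (stubs φ v).card * ((stubs φ v).card - 1) *
        ((farStubs φ v P).card * ((farStubs φ v P).card - 1)) /
        ((((2 * m : ℕ) : ℝ) - 1) * (((2 * m : ℕ) : ℝ) - 3)) :=
  matchAvg_factorial_two _ _ fun _ hs hs' => (mem_farStubs.1 hs').1 (mem_stubs.1 hs)

lemma nat_mul_pred_nonneg (k : ℕ) : (0 : ℝ) ≤ (k : ℝ) * (k - 1) := by
  rcases Nat.eq_zero_or_pos k with rfl | h
  · simp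
  · have : (1 : ℝ) ≤ k := by exact_mod_cast h
    exact mul_nonneg (by positivity) (by linarith)

lemma nat_mul_pred_mono {k l : ℕ} (h : k ≤ l) : (k : ℝ) * (k - 1) ≤ (l : ℝ) * (l - 1) := by
  rcases Nat.eq_zero_or_pos k with rfl | h0
  · simpa using nat_mul_pred_nonneg l
  · have h1 : (1 : ℝ) ≤ k := by exact_mod_cast h0
    have h2 : (k : ℝ) ≤ l := by exact_mod_cast h
    nlinarith

lemma nat_mul_pred_le_sq {k l : ℕ} (h : k ≤ l) : (k : ℝ) * (k - 1) ≤ (l : ℝ) ^ 2 := by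
  have := nat_mul_pred_mono h
  have h2 : (0 : ℝ) ≤ l := by positivity
  nlinarith

lemma collCount_mean_le (hφ : IsAlmostStubMap d φ) (hn : 8 ≤ n)
    (hN : (n : ℝ) - 1 ≤ ((2 * m : ℕ) : ℝ)) (v : Fin n) (P : Fin n → Prop) {B : ℕ}
    (hB : ∀ u, P u → d u ≤ B) :
    matchAvg (fun M => (collCount φ M v P : ℝ)) ≤ (d v : ℝ) ^ 2 * B * (4 / n) := by
  rw [matchAvg_collCount]
  set N : ℝ := ((2 * m : ℕ) : ℝ) with hNdef
  have hn' : (8 : ℝ) ≤ n := by exact_mod_cast hn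
  have h1 := nat_mul_pred_le_sq (card_stubs_le hφ v)
  have h2 : ((twinPairs φ v P).card : ℝ) ≤ N * B := by
    rw [hNdef, ← Nat.cast_mul]
    exact Nat.cast_le.2 (card_twinPairs_le hφ v P hB)
  have h3 : N / ((N - 1) * (N - 3)) ≤ 4 / n := by
    rw [div_le_div_iff₀ (by nlinarith) (by linarith)]
    nlinarith
  have h4 : 0 ≤ 1 / ((N - 1) * (N - 3)) := by
    apply div_nonneg zero_le_one; nlinarith
  calc _ ≤ (d v : ℝ) ^ 2 * (N * B) / ((N - 1) * (N - 3)) := by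
        apply div_le_div_of_nonneg_right _ (by nlinarith)
        exact mul_le_mul h1 h2 (by positivity) (by positivity)
    _ = (d v : ℝ) ^ 2 * B * (N / ((N - 1) * (N - 3))) := by ring
    _ ≤ _ := by gcongr

lemma matchAvg_card_lossy_le (hφ : IsAlmostStubMap d φ) (hn : 8 ≤ n)
    (hN : (n : ℝ) - 1 ≤ ((2 * m : ℕ) : ℝ)) {B : ℕ} (hB : ∀ v, d v ≤ B) (J : ℕ) :
    matchAvg (fun M => ((lossy d φ M J).card : ℝ)) ≤ 1 + (J : ℝ) ^ 2 * (2 + 4 * B) := by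
  have hn' : (8 : ℝ) ≤ n := by exact_mod_cast hn
  have hm : 1 ≤ m := by
    by_contra h
    have : m = 0 := by omega
    subst this
    norm_num at hN
    linarith
  set V : Finset (Fin n) := Finset.univ.filter fun v => d v ≤ J with hV
  have hpt : ∀ M ∈ matchings (2 * m), ((lossy d φ M J).card : ℝ) ≤
      1 + ∑ v ∈ V, ((((stubs φ v).filter fun s => M s ∈ stubs φ v).card : ℝ) +
        (collCount φ M v fun _ => True : ℕ)) := by
    intro M hM
    have h1 : (lossy d φ M J) ⊆ (Finset.univ.filter fun v => (stubs φ v).card ≠ d v) ∪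
        V.filter (fun v => 0 < ((stubs φ v).filter fun s => M s ∈ stubs φ v).card ∨
          0 < collCount φ M v fun _ => True) := by
      intro v hv
      simp only [lossy, Finset.mem_filter, Finset.mem_univ, true_and] at hv
      simp only [hV, Finset.mem_union, Finset.mem_filter, Finset.mem_univ, true_and]
      have := lossy_cases hM hv.2
      tauto
    have h2 := (Finset.card_le_card h1).trans (Finset.card_union_le _ _)
    have h3 : (V.filter (fun v => 0 < ((stubs φ v).filter fun s => M s ∈ stubs φ v).card ∨
          0 < collCount φ M v fun _ => True)).card ≤
        ∑ v ∈ V, (((stubs φ v).filter fun s => M s ∈ stubs φ v).card +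
          collCount φ M v fun _ => True) := by
      rw [Finset.card_filter]
      refine Finset.sum_le_sum fun v _ => ?_
      split_ifs <;> omega
    have h4 := card_defective_le_one hφ
    exact_mod_cast h2.trans (add_le_add h4 h3)
  refine (matchAvg_mono hpt).trans ?_
  rw [matchAvg_add, matchAvg_const, matchAvg_sum]
  have hv : ∀ v ∈ V, matchAvg (fun M =>
      (((stubs φ v).filter fun s => M s ∈ stubs φ v).card : ℝ) +
        (collCount φ M v fun _ => True : ℕ)) ≤ (J : ℝ) ^ 2 * (2 + 4 * B) / n := by
    intro v hv
    have hdJ : (d v : ℝ) ≤ J := by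
      rw [hV, Finset.mem_filter] at hv
      exact_mod_cast hv.2
    rw [matchAvg_add]
    have h1 := matchAvg_card_loops_le (stubs φ v) hm
    have h2 := collCount_mean_le hφ hn hN v (fun _ => True) (fun u _ => hB u)
    have h3 : ((stubs φ v).card : ℝ) ≤ J := by
      exact le_trans (by exact_mod_cast card_stubs_le hφ v) hdJ
    have h4 : ((stubs φ v).card : ℝ) * (stubs φ v).card / (((2 * m : ℕ) : ℝ) - 1) ≤
        (J : ℝ) ^ 2 * (2 / n) := by
      rw [← mul_div_assoc, div_le_div_iff₀ (by linarith) (by linarith)]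
      have h5 : ((stubs φ v).card : ℝ) * (stubs φ v).card ≤ (J : ℝ) ^ 2 := by
        rw [sq]; gcongr
      have h6 : (n : ℝ) ≤ 2 * (((2 * m : ℕ) : ℝ) - 1) := by linarith
      calc _ ≤ (J : ℝ) ^ 2 * (2 * (((2 * m : ℕ) : ℝ) - 1)) := by gcongr
        _ = _ := by ring
    have h7 : (d v : ℝ) ^ 2 * B * (4 / n) ≤ (J : ℝ) ^ 2 * B * (4 / n) := by gcongr
    calc _ ≤ (J : ℝ) ^ 2 * (2 / n) + (J : ℝ) ^ 2 * B * (4 / n) :=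
          add_le_add (h1.trans h4) (h2.trans h7)
      _ = _ := by ring
  have hcard : (V.card : ℝ) ≤ n := by
    have := Finset.card_le_univ V
    rw [Fintype.card_fin] at this
    exact_mod_cast this
  have := Finset.sum_le_card_nsmul V _ _ hv
  rw [nsmul_eq_mul] at this
  have h8 : (V.card : ℝ) * ((J : ℝ) ^ 2 * (2 + 4 * B) / n) ≤ (J : ℝ) ^ 2 * (2 + 4 * B) := by
    calc _ ≤ (n : ℝ) * ((J : ℝ) ^ 2 * (2 + 4 * B) / n) := by gcongr
      _ = _ := by field_simp
  linarith

lemma abs_work_sub_farCount_le (hφ : IsAlmostStubMap d φ) (hn : 8 ≤ n)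
    (hN : (n : ℝ) - 1 ≤ ((2 * m : ℕ) : ℝ)) {B : ℕ} (hB : ∀ v, d v ≤ B) {K J : ℕ} (hKJ : K ≤ J) :
    |matchAvg (fun M => ∑ v ∈ Finset.univ.filter (fun v => d v ≤ K),
        ((bucketCard φ M v : ℝ) * (bucketCard φ M v - 1))) -
      matchAvg (fun M => ∑ v ∈ Finset.univ.filter (fun v => d v ≤ K),
        ((farCount φ M v fun u => d v ≤ d u : ℝ) * ((farCount φ M v fun u => d v ≤ d u : ℝ) - 1)))|
      ≤ (K : ℝ) ^ 2 * ((1 + J) * (1 + (J : ℝ) ^ 2 * (2 + 4 * B)) +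
          ∑ w ∈ Finset.univ.filter (fun w => J < d w), (d w : ℝ)) := by
  rw [← matchAvg_sub]
  refine (abs_matchAvg_le _).trans ?_
  have hpt : ∀ M ∈ matchings (2 * m), |(∑ v ∈ Finset.univ.filter (fun v => d v ≤ K),
        ((bucketCard φ M v : ℝ) * (bucketCard φ M v - 1))) -
      ∑ v ∈ Finset.univ.filter (fun v => d v ≤ K),
        ((farCount φ M v fun u => d v ≤ d u : ℝ) * ((farCount φ M v fun u => d v ≤ d u : ℝ) - 1))|
      ≤ (K : ℝ) ^ 2 * ((1 + J) * ((lossy d φ M J).card : ℝ) +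
          ∑ w ∈ Finset.univ.filter (fun w => J < d w), (d w : ℝ)) := by
    intro M hM
    have hc := card_bucketCard_ne_farCount_le hφ hM hKJ
    have hc' : ((Finset.univ.filter fun v => d v ≤ K ∧
        bucketCard φ M v ≠ farCount φ M v fun u => d v ≤ d u).card : ℝ) ≤
      (1 + J) * ((lossy d φ M J).card : ℝ) +
        ∑ w ∈ Finset.univ.filter (fun w => J < d w), (d w : ℝ) := by exact_mod_cast hc
    rw [← Finset.sum_sub_distrib]
    refine (Finset.abs_sum_le_sum_abs _ _).trans ?_
    refine le_trans ?_ (mul_le_mul_of_nonneg_left hc' (by positivity))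
    rw [← Finset.filter_filter, Finset.card_filter]
    push_cast
    rw [Finset.mul_sum]
    refine Finset.sum_le_sum fun v hv => ?_
    have hv' : d v ≤ K := (Finset.mem_filter.1 hv).2
    by_cases he : bucketCard φ M v = farCount φ M v fun u => d v ≤ d u
    · simp [he]
    · rw [if_pos he, mul_one, abs_le]
      have a1 := nat_mul_pred_nonneg (bucketCard φ M v)
      have a2 := nat_mul_pred_nonneg (farCount φ M v fun u => d v ≤ d u)
      have a3 := nat_mul_pred_le_sq ((bucketCard_le hφ hM v).trans hv')
      have a4 := nat_mul_pred_le_sq ((farCount_le (M := M) hφ v fun u => d v ≤ d u).trans hv')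
      constructor <;> linarith
  refine (matchAvg_mono hpt).trans ?_
  rw [matchAvg_mul_left, matchAvg_add, matchAvg_mul_left, matchAvg_const]
  gcongr
  exact matchAvg_card_lossy_le hφ hn hN hB J

lemma abs_pair_ratio_sub_le {n N S a b k : ℝ} (hn : 8 ≤ n) (hN : n - 1 ≤ N) (hS : n ≤ S)
    (hNS : N ≤ S) (hSN : S ≤ N + 1) (ha : 0 ≤ a) (haN : a ≤ N) (hab : a ≤ b) (hbS : b ≤ S)
    (hba : b ≤ a + k) :
    |a * (a - 1) / ((N - 1) * (N - 3)) - (b / S) ^ 2| ≤ (2 * k + 18) / n := by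
  have hNpos : 0 < N := by linarith
  have hSpos : 0 < S := by linarith
  have hn0 : 0 < n := by linarith
  have hD : 0 < (N - 1) * (N - 3) := by apply mul_pos <;> linarith
  have h3 : N / ((N - 1) * (N - 3)) ≤ 4 / n := by
    rw [div_le_div_iff₀ hD hn0]
    nlinarith
  have h1 : |a * (a - 1) / ((N - 1) * (N - 3)) - (a / N) ^ 2| ≤ 16 / n := by
    have e : a * (a - 1) / ((N - 1) * (N - 3)) - (a / N) ^ 2 =
        (a / N) * ((4 * N * a - N ^ 2 - 3 * a) / N ^ 2) * (N / ((N - 1) * (N - 3))) := by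
      have : N - 1 ≠ 0 := by linarith
      have : N - 3 ≠ 0 := by linarith
      field_simp
      ring
    have i1 : |a / N| ≤ 1 := by
      rw [abs_of_nonneg (by positivity), div_le_one hNpos]; exact haN
    have i2 : |(4 * N * a - N ^ 2 - 3 * a) / N ^ 2| ≤ 4 := by
      rw [abs_div, abs_of_pos (by positivity : 0 < N ^ 2), div_le_iff₀ (by positivity), abs_le]
      constructor <;> nlinarith
    have i3 : |N / ((N - 1) * (N - 3))| ≤ 4 / n := by
      rw [abs_of_pos (by positivity)]; exact h3
    rw [e, abs_mul, abs_mul]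
    calc _ ≤ 1 * 4 * (4 / n) := by gcongr
      _ = _ := by ring
  have h2 : |(a / N) ^ 2 - (b / S) ^ 2| ≤ 2 * (k + 1) / n := by
    have e : (a / N) ^ 2 - (b / S) ^ 2 = (a / N + b / S) * (a / N - b / S) := by ring
    have i1 : |a / N + b / S| ≤ 2 := by
      rw [abs_of_nonneg (by have : 0 ≤ b := ha.trans hab
                            positivity)]
      have := (div_le_one hNpos).2 haN
      have := (div_le_one hSpos).2 hbS
      linarith
    have i2 : |a / N - b / S| ≤ (k + 1) / n := by
      have hk : 0 ≤ k := by linarith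
      have e2 : a / N - b / S = ((a / N) * (S - N) - (b - a)) / S := by
        field_simp
        ring
      have i3 := (div_le_one hNpos).2 haN
      have i4 : 0 ≤ a / N := by positivity
      rw [e2, abs_div, abs_of_pos hSpos]
      apply div_le_div₀ (by linarith) _ hn0 hS
      rw [abs_le]
      constructor <;> nlinarith
    rw [e, abs_mul]
    calc _ ≤ 2 * ((k + 1) / n) := by gcongr
      _ = _ := by ring
  calc _ ≤ |a * (a - 1) / ((N - 1) * (N - 3)) - (a / N) ^ 2| + |(a / N) ^ 2 - (b / S) ^ 2| :=
        abs_sub_le _ _ _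
    _ ≤ 16 / n + 2 * (k + 1) / n := add_le_add h1 h2
    _ = _ := by ring

/-- The total degree of the vertices satisfying `P`. -/
def degSum (d : Fin n → ℕ) (P : Fin n → Prop) : ℝ :=
  ∑ u ∈ Finset.univ.filter P, (d u : ℝ)

lemma degSum_eq (P : Fin n → Prop) [DecidablePred P] :
    degSum d P = ∑ u ∈ Finset.univ.filter P, (d u : ℝ) := by
  rw [degSum]
  congr!

lemma card_farStubs_le_degSum (hφ : IsAlmostStubMap d φ) (v : Fin n) (P : Fin n → Prop) :
    ((farStubs φ v P).card : ℝ) ≤ degSum d fun u => u ≠ v ∧ P u := by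
  rw [card_farStubs, degSum_eq]
  push_cast
  exact Finset.sum_le_sum fun u _ => (Nat.cast_le (α := ℝ)).2 (card_stubs_le hφ u)

lemma degSum_le_card_farStubs (hφ : IsAlmostStubMap d φ) (v : Fin n) (P : Fin n → Prop) :
    degSum d P ≤ (farStubs φ v P).card + ((d v : ℝ) + 1) := by
  have h1 : ∑ u ∈ Finset.univ.filter P, d u ≤
      ∑ u ∈ Finset.univ.filter (fun u => u ≠ v ∧ P u), d u + d v := by
    have hs : Finset.univ.filter P ⊆ insert v (Finset.univ.filter (fun u => u ≠ v ∧ P u)) := by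
      intro u hu
      simp only [Finset.mem_insert, Finset.mem_filter, Finset.mem_univ, true_and] at hu ⊢
      tauto
    refine (Finset.sum_le_sum_of_subset hs).trans ?_
    rw [Finset.sum_insert (by simp), add_comm]
  have h2 : ∑ u ∈ Finset.univ.filter (fun u => u ≠ v ∧ P u), d u ≤
      ∑ u ∈ Finset.univ.filter (fun u => u ≠ v ∧ P u), (stubs φ u).card + 1 := by
    have h3 : ∑ u ∈ Finset.univ.filter (fun u => u ≠ v ∧ P u), (d u - (stubs φ u).card) ≤ 1 :=
      (Finset.sum_le_sum_of_subset (Finset.subset_univ _)).trans hφ.2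
    calc _ = ∑ u ∈ Finset.univ.filter (fun u => u ≠ v ∧ P u),
          ((stubs φ u).card + (d u - (stubs φ u).card)) :=
          Finset.sum_congr rfl fun u _ => by have := card_stubs_le hφ u; omega
      _ ≤ _ := by rw [Finset.sum_add_distrib]; omega
  rw [card_farStubs, degSum_eq]
  have := h1.trans (Nat.add_le_add_right h2 (d v))
  have h4 : (∑ u ∈ Finset.univ.filter P, (d u : ℝ)) ≤
      ((∑ u ∈ Finset.univ.filter (fun u => u ≠ v ∧ P u), (stubs φ u).card : ℕ) : ℝ) + 1 + d v := by
    exact_mod_cast this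
  linarith

lemma degSum_mono {P Q : Fin n → Prop} (h : ∀ u, P u → Q u) : degSum d P ≤ degSum d Q := by
  refine Finset.sum_le_sum_of_subset_of_nonneg (fun u hu => ?_) fun _ _ _ => by positivity
  simp only [Finset.mem_filter, Finset.mem_univ, true_and] at hu ⊢
  exact h u hu

lemma degSum_nonneg (P : Fin n → Prop) : 0 ≤ degSum d P :=
  Finset.sum_nonneg fun _ _ => by positivity

/-- The degree-sequence approximation of the MinBucket work of the vertices of degree at most
`K` (up to a factor two). -/
def mainWork (d : Fin n → ℕ) (K : ℕ) : ℝ :=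
  ∑ v ∈ Finset.univ.filter (fun v => d v ≤ K),
    (d v : ℝ) * (d v - 1) * (degSum d (fun u => d v ≤ d u) / degSum d fun _ => True) ^ 2

lemma abs_farCount_sub_mainWork_le (hφ : IsAlmostStubMap d φ) (hn : 8 ≤ n)
    (hd : ∀ v, 1 ≤ d v) (hm : m = (∑ v, d v) / 2) (K : ℕ) :
    |matchAvg (fun M => ∑ v ∈ Finset.univ.filter (fun v => d v ≤ K),
        ((farCount φ M v fun u => d v ≤ d u : ℝ) * ((farCount φ M v fun u => d v ≤ d u : ℝ) - 1)))
      - mainWork d K| ≤ (K : ℝ) ^ 2 * (2 * K + 24) := by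
  have hn' : (8 : ℝ) ≤ n := by exact_mod_cast hn
  set S : ℝ := degSum d fun _ => True with hS
  set N : ℝ := ((2 * m : ℕ) : ℝ) with hN
  have hS' : S = ((∑ v, d v : ℕ) : ℝ) := by simp [hS, degSum]
  have hnS : (n : ℝ) ≤ S := by
    rw [hS']
    have : ∑ v : Fin n, 1 ≤ ∑ v, d v := Finset.sum_le_sum fun v _ => hd v
    simp only [Finset.sum_const, Finset.card_univ, Fintype.card_fin, smul_eq_mul, mul_one] at this
    exact_mod_cast this
  have hNS : N ≤ S := by
    rw [hS', hN]
    have : 2 * m ≤ ∑ v, d v := by omega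
    exact_mod_cast this
  have hSN : S ≤ N + 1 := by
    rw [hS', hN]
    have : ∑ v, d v ≤ 2 * m + 1 := by omega
    exact_mod_cast this
  rw [matchAvg_sum, mainWork, ← Finset.sum_sub_distrib]
  refine (Finset.abs_sum_le_sum_abs _ _).trans ?_
  have key : ∀ v ∈ Finset.univ.filter (fun v => d v ≤ K),
      |matchAvg (fun M =>
        ((farCount φ M v fun u => d v ≤ d u : ℝ) * ((farCount φ M v fun u => d v ≤ d u : ℝ) - 1)))
        - (d v : ℝ) * (d v - 1) * (degSum d (fun u => d v ≤ d u) / S) ^ 2| ≤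
      (K : ℝ) ^ 2 * ((2 * K + 20) / n) + if (stubs φ v).card ≠ d v then (K : ℝ) ^ 2 * 4 else 0 := by
    intro v hv
    have hvK : d v ≤ K := (Finset.mem_filter.1 hv).2
    have hvK' : (d v : ℝ) ≤ K := by exact_mod_cast hvK
    rw [matchAvg_farCount_two]
    set a : ℝ := ((farStubs φ v fun u => d v ≤ d u).card : ℝ) with ha
    set c : ℝ := ((stubs φ v).card : ℝ) with hc
    have haN : a + c ≤ N := by
      rw [ha, hc, hN]; exact_mod_cast card_farStubs_add_le v _
    have hc0 : 0 ≤ c := by positivity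
    have h0 : a ≤ degSum d fun u => d v ≤ d u :=
      (card_farStubs_le_degSum hφ v _).trans (degSum_mono fun u hu => hu.2)
    have hr := abs_pair_ratio_sub_le (k := (K : ℝ) + 1) hn' (by linarith : (n : ℝ) - 1 ≤ N) hnS hNS
      hSN (by positivity : 0 ≤ a) (by linarith) h0 (degSum_mono fun _ _ => trivial)
      ((degSum_le_card_farStubs hφ v _).trans (by linarith))
    set r : ℝ := a * (a - 1) / ((N - 1) * (N - 3)) with hrdef
    set q : ℝ := (degSum d (fun u => d v ≤ d u) / S) ^ 2 with hq
    have hr0 : 0 ≤ r := div_nonneg (nat_mul_pred_nonneg _) (by nlinarith)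
    have hr4 : r ≤ 4 := by
      rw [hrdef, div_le_iff₀ (by nlinarith)]
      have : 0 ≤ a := by positivity
      nlinarith
    have e : c * (c - 1) * (a * (a - 1)) / ((N - 1) * (N - 3)) - (d v : ℝ) * (d v - 1) * q =
        (d v : ℝ) * (d v - 1) * (r - q) - ((d v : ℝ) * (d v - 1) - c * (c - 1)) * r := by
      rw [hrdef]; ring
    have hdd0 := nat_mul_pred_nonneg (d v)
    have hddK := nat_mul_pred_le_sq hvK
    have hcc0 := nat_mul_pred_nonneg (stubs φ v).card
    have hccd := nat_mul_pred_mono (card_stubs_le hφ v)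
    rw [e]
    refine (abs_sub _ _).trans (add_le_add ?_ ?_)
    · rw [abs_mul, abs_of_nonneg hdd0]
      refine mul_le_mul hddK (hr.trans (le_of_eq ?_)) (abs_nonneg _) (by positivity)
      ring
    · by_cases hcd : (stubs φ v).card = d v
      · simp [hc, hcd]
      · rw [if_pos hcd, abs_of_nonneg (mul_nonneg (by rw [hc]; linarith) hr0)]
        refine mul_le_mul ?_ hr4 hr0 (by positivity)
        rw [hc]; linarith
  refine (Finset.sum_le_sum key).trans ?_
  rw [Finset.sum_add_distrib, ← Finset.sum_filter, Finset.sum_const, Finset.sum_const,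
    nsmul_eq_mul, nsmul_eq_mul]
  have hc1 : ((Finset.univ.filter fun v => d v ≤ K).card : ℝ) ≤ n := by
    have := Finset.card_le_univ (Finset.univ.filter fun v => d v ≤ K)
    rw [Fintype.card_fin] at this
    exact_mod_cast this
  have hc2 : (((Finset.univ.filter fun v => d v ≤ K).filter
      fun v => (stubs φ v).card ≠ d v).card : ℝ) ≤ 1 := by
    have := (Finset.card_le_card (Finset.filter_subset_filter (fun v => (stubs φ v).card ≠ d v)
      (Finset.subset_univ (Finset.univ.filter fun v => d v ≤ K)))).trans (card_defective_le_one hφ)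
    exact_mod_cast this
  calc _ ≤ (n : ℝ) * ((K : ℝ) ^ 2 * ((2 * K + 20) / n)) + 1 * ((K : ℝ) ^ 2 * 4) := by gcongr
    _ = _ := by field_simp; ring

end FixedStubs

section HighDegree

variable {n m : ℕ} {φ : Fin (2 * m) → Fin n} {d : Fin n → ℕ}

/-- A vertex whose degree at least halves has many collisions or few low-degree neighbours. -/
lemma sq_le_of_two_mul_ecmDeg_lt {M : Equiv.Perm (Fin (2 * m))} (hM : M ∈ matchings (2 * m))
    {v : Fin n} (P : Fin n → Prop) (h : 2 * ecmDeg φ M v < d v) {μ : ℝ}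
    (hμ : 11 * (d v : ℝ) / 16 ≤ μ) :
    (d v : ℝ) ^ 2 ≤ 8 * d v * collCount φ M v P + 256 * ((farCount φ M v P : ℝ) - μ) ^ 2 := by
  have h1 : (farCount φ M v P : ℝ) ≤ ecmDeg φ M v + collCount φ M v P := by
    exact_mod_cast farCount_le_ecmDeg_add hM v P
  have h2 : 2 * (ecmDeg φ M v : ℝ) < d v := by exact_mod_cast h
  have hd : (0 : ℝ) ≤ d v := by positivity
  have hc : (0 : ℝ) ≤ collCount φ M v P := by positivity
  by_cases hcoll : (d v : ℝ) ≤ 8 * collCount φ M v P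
  · nlinarith [sq_nonneg ((farCount φ M v P : ℝ) - μ)]
  · have h3 : (d v : ℝ) / 16 ≤ μ - farCount φ M v P := by linarith
    nlinarith [mul_nonneg hd hc]

/-- Chebyshev-type bound for the number of stubs of `v` matched into a given set of vertices. -/
lemma farCount_variance_le (hφ : IsAlmostStubMap d φ) (v : Fin n) (P : Fin n → Prop)
    (hN : (d v : ℝ) + 3 ≤ ((2 * m : ℕ) : ℝ)) (hv : 1 ≤ (stubs φ v).card) :
    matchAvg (fun M => ((farCount φ M v P : ℝ) -
      (stubs φ v).card * (farStubs φ v P).card / (((2 * m : ℕ) : ℝ) - 1)) ^ 2) ≤ 2 * d v := by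
  set N : ℝ := ((2 * m : ℕ) : ℝ) with hNdef
  set c : ℝ := ((stubs φ v).card : ℝ) with hc
  set a : ℝ := ((farStubs φ v P).card : ℝ) with ha
  set μ : ℝ := c * a / (N - 1) with hμ
  have e : (fun M : Equiv.Perm (Fin (2 * m)) => ((farCount φ M v P : ℝ) - μ) ^ 2) =
      fun M => ((farCount φ M v P : ℝ) * ((farCount φ M v P : ℝ) - 1) +
        (1 - 2 * μ) * (farCount φ M v P : ℝ)) + μ ^ 2 := by
    ext M; ring
  have hc1 : 1 ≤ c := by rw [hc]; exact_mod_cast hv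
  have hcd : c ≤ d v := Nat.cast_le.2 (card_stubs_le hφ v)
  have haN : a + c ≤ N := by
    rw [ha, hc, hNdef]; exact_mod_cast card_farStubs_add_le v _
  have ha0 : 0 ≤ a := by positivity
  rw [e, matchAvg_add, matchAvg_add, matchAvg_mul_left, matchAvg_const, matchAvg_farCount,
    matchAvg_farCount_two, ← hNdef, ← ha, ← hc, ← hμ]
  have hN1 : 0 < N - 1 := by linarith
  have hN3 : 0 < N - 3 := by linarith
  have hμd : μ ≤ c := by
    rw [hμ, div_le_iff₀ hN1]; nlinarith
  have hkey : c * (c - 1) * (a * (a - 1)) / ((N - 1) * (N - 3)) ≤ μ ^ 2 + c := by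
    have h1 : c * (c - 1) * (a * (a - 1)) / ((N - 1) * (N - 3)) =
        c * (c - 1) * ((a / (N - 1)) ^ 2 +
          (a / (N - 1)) * ((2 * a - N + 1) / (N - 1)) / (N - 3)) := by
      field_simp
      ring
    have h2 : a / (N - 1) ≤ 1 := by rw [div_le_one hN1]; linarith
    have h2' : 0 ≤ a / (N - 1) := by positivity
    have h3 : (2 * a - N + 1) / (N - 1) ≤ 1 := by rw [div_le_one hN1]; linarith
    have h4 : (a / (N - 1)) * ((2 * a - N + 1) / (N - 1)) ≤ 1 := by nlinarith
    have h5 : (a / (N - 1)) * ((2 * a - N + 1) / (N - 1)) / (N - 3) ≤ 1 / (N - 3) := by gcongr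
    have h6 : (c - 1) * (1 / (N - 3)) ≤ 1 := by
      rw [mul_one_div, div_le_one hN3]; linarith
    have h7 : c * (c - 1) * (a / (N - 1)) ^ 2 ≤ μ ^ 2 := by
      have : μ ^ 2 = c * c * (a / (N - 1)) ^ 2 := by rw [hμ]; ring
      rw [this]
      gcongr
      linarith
    rw [h1, mul_add]
    refine add_le_add h7 ?_
    calc _ ≤ c * (c - 1) * (1 / (N - 3)) := by
          gcongr
      _ = c * ((c - 1) * (1 / (N - 3))) := by ring
      _ ≤ c * 1 := by gcongr
      _ = c := mul_one c
  nlinarith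

lemma sum_high_ge (hφ : IsAlmostStubMap d φ) {K : ℕ} {v : Fin n} (hv : K < d v) :
    ((2 * m : ℕ) : ℝ) ≤ (farStubs φ v fun u => d u ≤ K).card + degSum d fun u => K < d u := by
  have h : 2 * m ≤ (farStubs φ v fun u => d u ≤ K).card +
      ∑ u ∈ Finset.univ.filter (fun u => K < d u), d u := by
    rw [card_farStubs]
    conv_lhs => rw [← sum_card_stubs (φ := φ)]
    rw [← Finset.sum_filter_add_sum_filter_not Finset.univ (fun u => u ≠ v ∧ d u ≤ K)]
    refine add_le_add (le_of_eq (by congr!)) ?_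
    refine (Finset.sum_le_sum_of_subset fun u hu => ?_).trans
      (Finset.sum_le_sum fun u _ => card_stubs_le hφ u)
    simp only [Finset.mem_filter, Finset.mem_univ, true_and, not_and, not_le] at hu ⊢
    by_cases huv : u = v
    · rwa [huv]
    · exact hu huv
  rw [degSum_eq]
  exact_mod_cast h

/-- The expected bucket work at a vertex of high prescribed degree. -/
lemma bucket_work_high_le (hφ : IsAlmostStubMap d φ) (hn : 8 ≤ n)
    (hN : (n : ℝ) - 1 ≤ ((2 * m : ℕ) : ℝ)) {K : ℕ} {v : Fin n} (hv : K < d v) (h12 : 12 ≤ d v)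
    (hdn : (d v : ℝ) + 4 ≤ n) :
    matchAvg (fun M => (bucketCard φ M v : ℝ) * (bucketCard φ M v - 1)) ≤
      4 / (n : ℝ) ^ 2 * ((d v : ℝ) ^ 2 * (degSum d fun u => u ≠ v ∧ d v ≤ 2 * d u) ^ 2) +
        (32 * K / n * (d v : ℝ) ^ 3 + 512 * d v) +
        if (n : ℝ) / 8 ≤ degSum d (fun u => K < d u) then (d v : ℝ) ^ 2 else 0 := by
  have hn' : (8 : ℝ) ≤ n := by exact_mod_cast hn
  set N : ℝ := ((2 * m : ℕ) : ℝ) with hNdef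
  have hd0 : (12 : ℝ) ≤ d v := by exact_mod_cast h12
  have hc1 : (d v : ℝ) ≤ (stubs φ v).card + 1 := by exact_mod_cast le_card_stubs_add_one hφ v
  have hcd : ((stubs φ v).card : ℝ) ≤ d v := Nat.cast_le.2 (card_stubs_le hφ v)
  have hD : 0 < (N - 1) * (N - 3) := by nlinarith
  have hDn : 1 / ((N - 1) * (N - 3)) ≤ 4 / (n : ℝ) ^ 2 := by
    rw [div_le_div_iff₀ hD (by positivity)]
    nlinarith
  have hgood : matchAvg (fun M => (farCount φ M v fun u => d v ≤ 2 * d u : ℝ) *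
      ((farCount φ M v fun u => d v ≤ 2 * d u : ℝ) - 1)) ≤
      4 / (n : ℝ) ^ 2 * ((d v : ℝ) ^ 2 * (degSum d fun u => u ≠ v ∧ d v ≤ 2 * d u) ^ 2) := by
    rw [matchAvg_farCount_two, div_eq_mul_one_div, mul_comm (4 / (n : ℝ) ^ 2)]
    have h1 := card_farStubs_le_degSum hφ v fun u => d v ≤ 2 * d u
    have h2 : (0 : ℝ) ≤ (farStubs φ v fun u => d v ≤ 2 * d u).card := by positivity
    refine mul_le_mul (mul_le_mul (nat_mul_pred_le_sq (card_stubs_le hφ v)) ?_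
      (nat_mul_pred_nonneg _) (by positivity)) hDn (by positivity) (by positivity)
    nlinarith
  have hsq0 : (0 : ℝ) ≤ if (n : ℝ) / 8 ≤ degSum d (fun u => K < d u) then (d v : ℝ) ^ 2 else 0 := by
    split_ifs <;> positivity
  have hbad : matchAvg (fun M => if 2 * ecmDeg φ M v < d v then (d v : ℝ) ^ 2 else 0) ≤
      (32 * K / n * (d v : ℝ) ^ 3 + 512 * d v) +
        if (n : ℝ) / 8 ≤ degSum d (fun u => K < d u) then (d v : ℝ) ^ 2 else 0 := by
    by_cases hlow : 4 * ((farStubs φ v fun u => d u ≤ K).card : ℝ) < 3 * (N - 1)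
    · have h1 := sum_high_ge hφ hv
      rw [← hNdef] at h1
      have h2 : (n : ℝ) / 8 ≤ degSum d fun u => K < d u := by linarith
      rw [if_pos h2]
      have h3 : matchAvg (fun M => if 2 * ecmDeg φ M v < d v then (d v : ℝ) ^ 2 else 0) ≤
          matchAvg (fun _ : Equiv.Perm (Fin (2 * m)) => (d v : ℝ) ^ 2) := by
        refine matchAvg_mono fun M _ => ?_
        split_ifs
        · exact le_rfl
        · positivity
      rw [matchAvg_const] at h3
      have h4 : (0 : ℝ) ≤ 32 * K / n * (d v : ℝ) ^ 3 + 512 * d v := by positivity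
      linarith
    · rw [not_lt] at hlow
      set μ : ℝ := (stubs φ v).card * (farStubs φ v fun u => d u ≤ K).card / (N - 1) with hμ
      have hμ' : 11 * (d v : ℝ) / 16 ≤ μ := by
        rw [hμ, le_div_iff₀ (by linarith)]
        have : 11 * (d v : ℝ) / 16 ≤ (stubs φ v).card * (3 / 4) := by linarith
        nlinarith
      have h1 : matchAvg (fun M => if 2 * ecmDeg φ M v < d v then (d v : ℝ) ^ 2 else 0) ≤
          matchAvg fun M => 8 * d v * (collCount φ M v (fun u => d u ≤ K) : ℝ) +
            256 * ((farCount φ M v (fun u => d u ≤ K) : ℝ) - μ) ^ 2 := by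
        refine matchAvg_mono fun M hM => ?_
        split_ifs with h
        · exact sq_le_of_two_mul_ecmDeg_lt hM _ h hμ'
        · positivity
      rw [matchAvg_add, matchAvg_mul_left, matchAvg_mul_left] at h1
      have h2 := collCount_mean_le hφ hn hN v (fun u => d u ≤ K) (B := K) (fun _ h => h)
      have h3 := farCount_variance_le hφ v (fun u => d u ≤ K) (by linarith) (by
        have : (1 : ℝ) ≤ (stubs φ v).card := by linarith
        exact_mod_cast this)
      have h4 : 8 * (d v : ℝ) * matchAvg (fun M => (collCount φ M v fun u => d u ≤ K : ℝ)) ≤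
          8 * d v * ((d v : ℝ) ^ 2 * K * (4 / n)) := by gcongr
      have h5 : 8 * (d v : ℝ) * ((d v : ℝ) ^ 2 * K * (4 / n)) = 32 * K / n * (d v : ℝ) ^ 3 := by
        ring
      rw [← hNdef, ← hμ] at h3
      linarith
  have hpt : matchAvg (fun M => (bucketCard φ M v : ℝ) * (bucketCard φ M v - 1)) ≤
      matchAvg fun M => (farCount φ M v fun u => d v ≤ 2 * d u : ℝ) *
        ((farCount φ M v fun u => d v ≤ 2 * d u : ℝ) - 1) +
        if 2 * ecmDeg φ M v < d v then (d v : ℝ) ^ 2 else 0 := by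
    refine matchAvg_mono fun M hM => ?_
    split_ifs with h
    · have h1 := nat_mul_pred_le_sq (bucketCard_le hφ hM v)
      have h2 := nat_mul_pred_nonneg (farCount φ M v fun u => d v ≤ 2 * d u)
      linarith
    · rw [add_zero]
      exact nat_mul_pred_mono (bucketCard_le_farCount hφ hM (not_lt.1 h))
  rw [matchAvg_add] at hpt
  linarith

end HighDegree

section Work

variable {n : ℕ} {d : Fin n → ℕ}

lemma exists_isAlmostStubMap (d : Fin n → ℕ) :
    ∃ φ : Fin (2 * ((∑ v, d v) / 2)) → Fin n, IsAlmostStubMap d φ := by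
  have hle : 2 * ((∑ v, d v) / 2) ≤ ∑ v, d v := by omega
  let e : Fin (2 * ((∑ v, d v) / 2)) → (v : Fin n) × Fin (d v) :=
    fun s => finSigmaFinEquiv.symm (Fin.castLE hle s)
  have he : Function.Injective e :=
    finSigmaFinEquiv.symm.injective.comp (Fin.castLE_injective hle)
  have h1 : ∀ v, (Finset.univ.filter fun s => (e s).1 = v).card ≤ d v := by
    intro v
    rw [← Finset.card_image_of_injective _ he]
    have hsub : (Finset.univ.filter fun s => (e s).1 = v).image e ⊆
        (Finset.univ : Finset (Fin (d v))).image (Sigma.mk v) := by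
      intro x hx
      obtain ⟨s, hs, rfl⟩ := Finset.mem_image.1 hx
      have hs' : (e s).1 = v := by simpa using hs
      subst hs'
      exact Finset.mem_image.2 ⟨(e s).2, Finset.mem_univ _, rfl⟩
    refine (Finset.card_le_card hsub).trans (Finset.card_image_le.trans ?_)
    simp
  refine ⟨fun s => (e s).1, h1, ?_⟩
  have h2 := sum_card_stubs (φ := fun s => (e s).1)
  simp only [stubs] at h2
  rw [Finset.sum_tsub_distrib _ fun v _ => h1 v, h2]
  omega

lemma ecmWork_eq (d : Fin n → ℕ) :
    ecmWork d = (∑ φ ∈ (Finset.univ :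
        Finset (Fin (2 * ((∑ v, d v) / 2)) → Fin n)).filter (IsAlmostStubMap d),
        matchAvg fun M => ∑ v, ecmX₂ φ M v * (ecmX₂ φ M v - 1) / 2) /
      (((Finset.univ : Finset (Fin (2 * ((∑ v, d v) / 2)) → Fin n)).filter
        (IsAlmostStubMap d)).card : ℝ) := by
  simp only [ecmWork, matchAvg]
  rw [← Finset.sum_div, div_div, mul_comm ((matchings _).card : ℝ)]

lemma matchAvg_work {m : ℕ} (φ : Fin (2 * m) → Fin n) (K : ℕ) :
    2 * (matchAvg fun M => ∑ v, ecmX₂ φ M v * (ecmX₂ φ M v - 1) / 2) =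
      matchAvg (fun M => ∑ v ∈ Finset.univ.filter (fun v => d v ≤ K),
        ((bucketCard φ M v : ℝ) * (bucketCard φ M v - 1))) +
      ∑ v ∈ Finset.univ.filter (fun v => K < d v),
        matchAvg fun M => (bucketCard φ M v : ℝ) * (bucketCard φ M v - 1) := by
  rw [← matchAvg_mul_left, ← matchAvg_sum, ← matchAvg_add]
  congr 1
  ext M
  simp only [ecmX₂_eq]
  rw [← Finset.sum_div, mul_div_cancel₀ _ two_ne_zero,
    ← Finset.sum_filter_add_sum_filter_not Finset.univ (fun v => d v ≤ K)]
  simp only [not_le]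

lemma abs_ecmWork_sub_le {a ε : ℝ}
    (h : ∀ φ : Fin (2 * ((∑ v, d v) / 2)) → Fin n, IsAlmostStubMap d φ →
      |2 * (matchAvg fun M => ∑ v, ecmX₂ φ M v * (ecmX₂ φ M v - 1) / 2) - a| ≤ ε) :
    |2 * ecmWork d - a| ≤ ε := by
  set A := (Finset.univ : Finset (Fin (2 * ((∑ v, d v) / 2)) → Fin n)).filter (IsAlmostStubMap d)
    with hA
  have hpos : 0 < (A.card : ℝ) := by
    obtain ⟨φ, hφ⟩ := exists_isAlmostStubMap d
    exact_mod_cast Finset.card_pos.2 ⟨φ, Finset.mem_filter.2 ⟨Finset.mem_univ _, hφ⟩⟩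
  have e : 2 * ecmWork d - a = (∑ φ ∈ A,
      (2 * (matchAvg fun M => ∑ v, ecmX₂ φ M v * (ecmX₂ φ M v - 1) / 2) - a)) / A.card := by
    rw [ecmWork_eq, ← hA, Finset.sum_sub_distrib, ← Finset.mul_sum, Finset.sum_const, nsmul_eq_mul]
    field_simp
  rw [e, abs_div, Nat.abs_cast, div_le_iff₀ hpos]
  refine (Finset.abs_sum_le_sum_abs _ _).trans ?_
  refine (Finset.sum_le_card_nsmul A _ ε fun φ hφ => h φ (Finset.mem_filter.1 hφ).2).trans ?_
  rw [nsmul_eq_mul, mul_comm]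

/-- The contribution to the error bound of a vertex of high prescribed degree. -/
def highError (d : Fin n → ℕ) (K₀ : ℕ) (v : Fin n) : ℝ :=
  4 / (n : ℝ) ^ 2 * ((d v : ℝ) ^ 2 * (degSum d fun u => u ≠ v ∧ d v ≤ 2 * d u) ^ 2) +
    (32 * K₀ / n * (d v : ℝ) ^ 3 + 512 * d v) +
    if (n : ℝ) / 8 ≤ degSum d (fun u => K₀ < d u) then (d v : ℝ) ^ 2 else 0

lemma abs_ecmWork_sub_mainWork_le (hn : 8 ≤ n) (hd : ∀ v, 1 ≤ d v) {B : ℕ} (hB : ∀ v, d v ≤ B)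
    (hBn : B + 4 ≤ n) {K₀ K J : ℕ} (hK : 12 ≤ K) (hK₀ : K₀ ≤ K) (hKJ : K ≤ J) :
    |2 * ecmWork d - mainWork d K| ≤
      (K : ℝ) ^ 2 * ((1 + J) * (1 + (J : ℝ) ^ 2 * (2 + 4 * B)) + degSum d fun u => J < d u) +
      (K : ℝ) ^ 2 * (2 * K + 24) +
      ∑ v ∈ Finset.univ.filter (fun v => K < d v), highError d K₀ v := by
  refine abs_ecmWork_sub_le fun φ hφ => ?_
  have hN : (n : ℝ) - 1 ≤ ((2 * ((∑ v, d v) / 2) : ℕ) : ℝ) := by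
    have h1 : ∑ v : Fin n, 1 ≤ ∑ v, d v := Finset.sum_le_sum fun v _ => hd v
    simp only [Finset.sum_const, Finset.card_univ, Fintype.card_fin, smul_eq_mul, mul_one] at h1
    have h2 : n ≤ 2 * ((∑ v, d v) / 2) + 1 := by omega
    have h3 : (n : ℝ) ≤ ((2 * ((∑ v, d v) / 2) : ℕ) : ℝ) + 1 := by exact_mod_cast h2
    linarith
  have hBn' : (B : ℝ) + 4 ≤ n := by exact_mod_cast hBn
  rw [matchAvg_work (d := d) φ K]
  have h1 := abs_work_sub_farCount_le hφ hn hN hB hKJ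
  have h2 := abs_farCount_sub_mainWork_le hφ hn hd rfl K
  have h3 : |∑ v ∈ Finset.univ.filter (fun v => K < d v),
        matchAvg fun M => (bucketCard φ M v : ℝ) * (bucketCard φ M v - 1)| ≤
      ∑ v ∈ Finset.univ.filter (fun v => K < d v), highError d K₀ v := by
    rw [abs_of_nonneg (Finset.sum_nonneg fun v _ => matchAvg_nonneg fun M _ =>
      nat_mul_pred_nonneg _)]
    refine Finset.sum_le_sum fun v hv => ?_
    have hv' : K < d v := (Finset.mem_filter.1 hv).2
    have hdB : (d v : ℝ) ≤ B := by exact_mod_cast hB v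
    exact bucket_work_high_le hφ hn hN (hK₀.trans_lt hv') (by omega) (by linarith)
  rw [degSum_eq]
  rw [abs_le] at *
  constructor <;> linarith [h1.1, h1.2, h2.1, h2.2, h3.1, h3.2]

end Work

/-- The mean of `g` under the mass function `p` on the finite set `S`. -/
def wMean (S : Finset ℕ) (p g : ℕ → ℝ) : ℝ := ∑ t ∈ S, p t * g t

/-- The mean of `F` over sequences of `n` independent samples of the mass function `p` on `S`. -/
def iidMean (S : Finset ℕ) (p : ℕ → ℝ) {n : ℕ} (F : (Fin n → ℕ) → ℝ) : ℝ :=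
  ∑ d ∈ Fintype.piFinset (fun _ : Fin n => S), (∏ i, p (d i)) * F d

section Iid

variable {S : Finset ℕ} {p : ℕ → ℝ} {n : ℕ}

lemma wMean_mono (hp : ∀ t ∈ S, 0 ≤ p t) {g h : ℕ → ℝ} (hgh : ∀ t ∈ S, g t ≤ h t) :
    wMean S p g ≤ wMean S p h :=
  Finset.sum_le_sum fun t ht => mul_le_mul_of_nonneg_left (hgh t ht) (hp t ht)

lemma wMean_nonneg (hp : ∀ t ∈ S, 0 ≤ p t) {g : ℕ → ℝ} (hg : ∀ t ∈ S, 0 ≤ g t) :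
    0 ≤ wMean S p g :=
  Finset.sum_nonneg fun t ht => mul_nonneg (hp t ht) (hg t ht)

lemma wMean_const_mul (c : ℝ) (g : ℕ → ℝ) : wMean S p (fun t => c * g t) = c * wMean S p g := by
  rw [wMean, wMean, Finset.mul_sum]
  exact Finset.sum_congr rfl fun t _ => by ring

lemma wMean_const (hp1 : ∑ t ∈ S, p t = 1) (c : ℝ) : wMean S p (fun _ => c) = c := by
  rw [wMean, ← Finset.sum_mul, hp1, one_mul]

lemma wMean_sub (g h : ℕ → ℝ) :
    wMean S p (fun t => g t - h t) = wMean S p g - wMean S p h := by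
  simp only [wMean, mul_sub, Finset.sum_sub_distrib]

lemma iidMean_mono (hp : ∀ t ∈ S, 0 ≤ p t) {F G : (Fin n → ℕ) → ℝ}
    (h : ∀ d : Fin n → ℕ, (∀ i, d i ∈ S) → F d ≤ G d) : iidMean S p F ≤ iidMean S p G := by
  refine Finset.sum_le_sum fun d hd => mul_le_mul_of_nonneg_left (h d ?_) ?_
  · exact Fintype.mem_piFinset.1 hd
  · exact Finset.prod_nonneg fun i _ => hp _ (Fintype.mem_piFinset.1 hd i)

lemma iidMean_add (F G : (Fin n → ℕ) → ℝ) :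
    iidMean S p (fun d => F d + G d) = iidMean S p F + iidMean S p G := by
  simp only [iidMean, mul_add, Finset.sum_add_distrib]

lemma iidMean_sub (F G : (Fin n → ℕ) → ℝ) :
    iidMean S p (fun d => F d - G d) = iidMean S p F - iidMean S p G := by
  simp only [iidMean, mul_sub, Finset.sum_sub_distrib]

lemma iidMean_const_mul (c : ℝ) (F : (Fin n → ℕ) → ℝ) :
    iidMean S p (fun d => c * F d) = c * iidMean S p F := by
  rw [iidMean, iidMean, Finset.mul_sum]
  exact Finset.sum_congr rfl fun t _ => by ring

lemma iidMean_sum {ι : Type*} (T : Finset ι) (F : ι → (Fin n → ℕ) → ℝ) :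
    iidMean S p (fun d => ∑ j ∈ T, F j d) = ∑ j ∈ T, iidMean S p (F j) := by
  simp only [iidMean, Finset.mul_sum]
  exact Finset.sum_comm

lemma abs_iidMean_le (hp : ∀ t ∈ S, 0 ≤ p t) (F : (Fin n → ℕ) → ℝ) :
    |iidMean S p F| ≤ iidMean S p fun d => |F d| := by
  refine (Finset.abs_sum_le_sum_abs _ _).trans (le_of_eq (Finset.sum_congr rfl fun d hd => ?_))
  rw [abs_mul, abs_of_nonneg
    (Finset.prod_nonneg fun i _ => hp _ (Fintype.mem_piFinset.1 hd i))]

lemma iidMean_prod (hp1 : ∑ t ∈ S, p t = 1) (T : Finset (Fin n)) (g : Fin n → ℕ → ℝ) :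
    iidMean S p (fun d => ∏ i ∈ T, g i (d i)) = ∏ i ∈ T, wMean S p (g i) := by
  have h : ∀ d : Fin n → ℕ, (∏ i, p (d i)) * ∏ i ∈ T, g i (d i) =
      ∏ i, p (d i) * (if i ∈ T then g i (d i) else 1) := by
    intro d
    rw [Finset.prod_mul_distrib, Finset.prod_ite_mem, Finset.univ_inter]
  simp only [iidMean, h]
  rw [← Finset.prod_univ_sum (fun _ : Fin n => S)
    (fun i t => p t * (if i ∈ T then g i t else 1))]
  rw [← Finset.prod_subset (Finset.subset_univ T)]
  · exact Finset.prod_congr rfl fun i hi => by simp only [hi, if_true, wMean]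
  · intro i _ hi
    simpa only [hi, if_false, mul_one] using hp1

lemma iidMean_const (hp1 : ∑ t ∈ S, p t = 1) (c : ℝ) :
    iidMean S p (fun _ : Fin n → ℕ => c) = c := by
  have h := iidMean_const_mul (S := S) (p := p) (n := n) c fun _ => 1
  have h1 := iidMean_prod (S := S) (p := p) (n := n) hp1 ∅ fun _ _ => 1
  simp only [Finset.prod_empty] at h1
  simpa [h1] using h

lemma iidMean_one (hp1 : ∑ t ∈ S, p t = 1) (v : Fin n) (g : ℕ → ℝ) :
    iidMean S p (fun d => g (d v)) = wMean S p g := by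
  simpa using iidMean_prod (S := S) (p := p) hp1 {v} fun _ => g

lemma iidMean_two (hp1 : ∑ t ∈ S, p t = 1) {v u : Fin n} (huv : u ≠ v) (g h : ℕ → ℝ) :
    iidMean S p (fun d => g (d v) * h (d u)) = wMean S p g * wMean S p h := by
  simpa [Finset.prod_pair huv.symm, huv] using
    iidMean_prod (S := S) (p := p) hp1 {v, u} fun i => if i = v then g else h

lemma iidMean_three (hp1 : ∑ t ∈ S, p t = 1) {v u w : Fin n} (huv : u ≠ v) (hwv : w ≠ v)
    (huw : u ≠ w) (g h : ℕ → ℝ) :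
    iidMean S p (fun d => g (d v) * (h (d u) * h (d w))) =
      wMean S p g * (wMean S p h * wMean S p h) := by
  have h1 : v ∉ ({u, w} : Finset (Fin n)) := by simp [huv.symm, hwv.symm]
  simpa [Finset.prod_insert h1, Finset.prod_pair huw, huv, hwv] using
    iidMean_prod (S := S) (p := p) hp1 {v, u, w} fun i => if i = v then g else h

lemma iidMean_mul_sq_sum_le (hp : ∀ t ∈ S, 0 ≤ p t) (hp1 : ∑ t ∈ S, p t = 1) (v : Fin n)
    {g : ℕ → ℝ} (hg : ∀ t ∈ S, 0 ≤ g t) (h : ℕ → ℝ) :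
    iidMean S p (fun d => g (d v) * (∑ u ∈ Finset.univ.erase v, h (d u)) ^ 2) ≤
      wMean S p g * (n * wMean S p (fun t => h t ^ 2) + n ^ 2 * wMean S p h ^ 2) := by
  have e : ∀ d : Fin n → ℕ, g (d v) * (∑ u ∈ Finset.univ.erase v, h (d u)) ^ 2 =
      ∑ u ∈ Finset.univ.erase v, ∑ w ∈ Finset.univ.erase v, g (d v) * (h (d u) * h (d w)) := by
    intro d
    rw [sq, Finset.sum_mul_sum, Finset.mul_sum]
    exact Finset.sum_congr rfl fun u _ => Finset.mul_sum _ _ _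
  have hg0 := wMean_nonneg hp hg
  have hh0 : 0 ≤ wMean S p (fun t => h t ^ 2) := wMean_nonneg hp fun t _ => sq_nonneg _
  have hpt : ∀ u ∈ Finset.univ.erase v, ∀ w ∈ Finset.univ.erase v,
      iidMean S p (fun d => g (d v) * (h (d u) * h (d w))) ≤
        wMean S p g * ((if u = w then wMean S p (fun t => h t ^ 2) else 0) +
          wMean S p h ^ 2) := by
    intro u hu w hw
    have hu' := (Finset.mem_erase.1 hu).1
    have hw' := (Finset.mem_erase.1 hw).1
    by_cases huw : u = w
    · subst huw
      have := iidMean_two hp1 hu' g fun t => h t ^ 2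
      simp only [← sq, this, if_true]
      exact mul_le_mul_of_nonneg_left (by nlinarith [sq_nonneg (wMean S p h)]) hg0
    · rw [iidMean_three hp1 hu' hw' huw, if_neg huw, zero_add, sq]
  simp only [e, iidMean_sum]
  refine (Finset.sum_le_sum fun u hu => Finset.sum_le_sum fun w hw => hpt u hu w hw).trans ?_
  simp only [← Finset.mul_sum]
  refine mul_le_mul_of_nonneg_left ?_ hg0
  refine (Finset.sum_le_sum_of_subset_of_nonneg (Finset.subset_univ _) fun u _ _ =>
    Finset.sum_nonneg fun w _ => by split_ifs <;> positivity).trans ?_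
  refine (Finset.sum_le_sum fun u _ =>
    Finset.sum_le_sum_of_subset_of_nonneg (Finset.subset_univ _) fun w _ _ => by
      split_ifs <;> positivity).trans ?_
  simp [Finset.sum_add_distrib]
  exact le_of_eq (by ring)

lemma iidMean_mul_sq_centred_le (hp : ∀ t ∈ S, 0 ≤ p t) (hp1 : ∑ t ∈ S, p t = 1) (v : Fin n)
    {g : ℕ → ℝ} (hg : ∀ t ∈ S, 0 ≤ g t) {h : ℕ → ℝ} (hh : wMean S p h = 0) :
    iidMean S p (fun d => g (d v) * (∑ u, h (d u)) ^ 2) ≤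
      2 * wMean S p (fun t => g t * h t ^ 2) +
        2 * (wMean S p g * (n * wMean S p (fun t => h t ^ 2))) := by
  have h1 : iidMean S p (fun d => g (d v) * (∑ u, h (d u)) ^ 2) ≤
      iidMean S p (fun d => 2 * (g (d v) * h (d v) ^ 2) +
        2 * (g (d v) * (∑ u ∈ Finset.univ.erase v, h (d u)) ^ 2)) := by
    refine iidMean_mono hp fun d hd => ?_
    rw [← Finset.add_sum_erase _ _ (Finset.mem_univ v)]
    have h2 := mul_nonneg (hg _ (hd v))
      (sq_nonneg (h (d v) - ∑ u ∈ Finset.univ.erase v, h (d u)))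
    linarith
  have h2 := iidMean_mul_sq_sum_le hp hp1 v hg h
  rw [hh] at h2
  rw [iidMean_add, iidMean_const_mul, iidMean_const_mul,
    iidMean_one hp1 v fun t => g t * h t ^ 2] at h1
  linarith

end Iid

section Sampling

variable {S : Finset ℕ} {p : ℕ → ℝ} {n : ℕ}

lemma iidMean_abs_le_sqrt (hp : ∀ t ∈ S, 0 ≤ p t) (hp1 : ∑ t ∈ S, p t = 1)
    (F : (Fin n → ℕ) → ℝ) :
    iidMean S p (fun d => |F d|) ≤ √(iidMean S p fun d => F d ^ 2) := by
  set m := iidMean S p fun d => |F d| with hm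
  refine Real.le_sqrt_of_sq_le ?_
  have h1 : iidMean S p (fun _ : Fin n → ℕ => (0 : ℝ)) ≤
      iidMean S p fun d => F d ^ 2 - 2 * m * |F d| + m ^ 2 := by
    refine iidMean_mono hp fun d _ => ?_
    rw [← sq_abs (F d)]
    nlinarith [sq_nonneg (|F d| - m)]
  rw [iidMean_const hp1, iidMean_add, iidMean_sub, iidMean_const_mul, iidMean_const hp1,
    ← hm] at h1
  linarith

lemma wMean_sq_sub_le (hp1 : ∑ t ∈ S, p t = 1) (g : ℕ → ℝ) :
    wMean S p (fun t => (g t - wMean S p g) ^ 2) ≤ wMean S p fun t => g t ^ 2 := by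
  set m := wMean S p g with hm
  have h : wMean S p (fun t => (g t - m) ^ 2) =
      wMean S p (fun t => g t ^ 2) - (2 * m * wMean S p g - m ^ 2) := by
    rw [← wMean_const_mul, ← wMean_const hp1 (m ^ 2), ← wMean_sub, ← wMean_sub]
    congr 1
    ext t
    ring
  rw [h, ← hm]
  nlinarith [sq_nonneg m]

lemma wMean_sub_mean (hp1 : ∑ t ∈ S, p t = 1) (g : ℕ → ℝ) :
    wMean S p (fun t => g t - wMean S p g) = 0 := by
  rw [wMean_sub, wMean_const hp1, sub_self]

lemma iidMean_abs_avg_sub_le (hp : ∀ t ∈ S, 0 ≤ p t) (hp1 : ∑ t ∈ S, p t = 1) (hn : 0 < n)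
    (g : ℕ → ℝ) (m : ℝ) :
    iidMean S p (fun d : Fin n → ℕ => |(∑ u, g (d u)) / n - m|) ≤
      |wMean S p g - m| + √(4 * wMean S p (fun t => g t ^ 2) / n) := by
  have hn' : (0 : ℝ) < n := by exact_mod_cast hn
  have hn1 : (1 : ℝ) ≤ n := by exact_mod_cast hn
  set c := wMean S p g with hc
  have h1 : iidMean S p (fun d : Fin n → ℕ => |(∑ u, g (d u)) / n - m|) ≤
      iidMean S p fun d : Fin n → ℕ => |c - m| + |(∑ u, (g (d u) - c)) / n| := by
    refine iidMean_mono hp fun d _ => ?_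
    have e : (∑ u, g (d u)) / n - m = (c - m) + (∑ u, (g (d u) - c)) / n := by
      rw [Finset.sum_sub_distrib]
      simp only [Finset.sum_const, Finset.card_univ, Fintype.card_fin, nsmul_eq_mul]
      field_simp
      ring
    rw [e]
    exact abs_add_le _ _
  rw [iidMean_add, iidMean_const hp1] at h1
  refine h1.trans (add_le_add le_rfl ((iidMean_abs_le_sqrt hp hp1 _).trans
    (Real.sqrt_le_sqrt ?_)))
  have h2 := iidMean_mul_sq_centred_le hp hp1 (⟨0, hn⟩ : Fin n) (g := fun _ => 1)
    (fun _ _ => zero_le_one) (wMean_sub_mean hp1 g)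
  simp only [one_mul, wMean_const hp1] at h2
  have h3 := wMean_sq_sub_le hp1 g
  have h4 : 0 ≤ wMean S p fun t => (g t - wMean S p g) ^ 2 :=
    wMean_nonneg hp fun t _ => sq_nonneg _
  have e : (fun d : Fin n → ℕ => ((∑ u, (g (d u) - c)) / n) ^ 2) =
      fun d => (1 / (n : ℝ) ^ 2) * (∑ u, (g (d u) - c)) ^ 2 := by
    ext d
    rw [div_pow]
    ring
  rw [e, iidMean_const_mul]
  calc _ ≤ 1 / (n : ℝ) ^ 2 * (4 * n * wMean S p fun t => g t ^ 2) := by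
        refine mul_le_mul_of_nonneg_left (h2.trans ?_) (by positivity)
        nlinarith
    _ = _ := by field_simp

lemma degSum_eq_sum (d : Fin n → ℕ) (P : ℕ → Prop) [DecidablePred P] :
    degSum d (fun u => P (d u)) = ∑ u, if P (d u) then (d u : ℝ) else 0 := by
  rw [degSum_eq, Finset.sum_filter]

lemma le_degSum_true {d : Fin n → ℕ} (hd : ∀ v, 1 ≤ d v) : (n : ℝ) ≤ degSum d fun _ => True := by
  rw [degSum_eq]
  have : ∑ v : Fin n, (1 : ℝ) ≤ ∑ v, (d v : ℝ) :=
    Finset.sum_le_sum fun v _ => by exact_mod_cast hd v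
  simpa using this

lemma abs_mul_sq_ratio_sub_le {a a' G S γ μ : ℝ} (ha' : 0 ≤ a') (ha'1 : a' ≤ 1)
    (hG : 0 ≤ G) (hGS : G ≤ S) (hS : 1 ≤ S) (hγ : 0 ≤ γ) (hγμ : γ ≤ μ) (hμ : 0 < μ) :
    |a * (G / S) ^ 2 - a' * (γ / μ) ^ 2| ≤ |a - a'| + 2 * (|G - γ| + |S - μ|) := by
  have hS0 : 0 < S := by linarith
  have hb0 : 0 ≤ G / S := by positivity
  have hb1 : G / S ≤ 1 := (div_le_one hS0).2 hGS
  have hc0 : 0 ≤ γ / μ := by positivity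
  have hc1 : γ / μ ≤ 1 := (div_le_one hμ).2 hγμ
  have h1 : |G / S - γ / μ| ≤ |G - γ| + |S - μ| := by
    have e : G / S - γ / μ = (G - γ) / S + γ / μ * ((μ - S) / S) := by field_simp; ring
    rw [e]
    refine (abs_add_le _ _).trans (add_le_add ?_ ?_)
    · rw [abs_div, abs_of_pos hS0]
      exact div_le_self (abs_nonneg _) hS
    · rw [abs_mul, abs_of_nonneg hc0, abs_div, abs_of_pos hS0, abs_sub_comm]
      exact (mul_le_of_le_one_left (by positivity) hc1).trans (div_le_self (abs_nonneg _) hS)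
  have e : a * (G / S) ^ 2 - a' * (γ / μ) ^ 2 =
      (a - a') * (G / S) ^ 2 + a' * (G / S + γ / μ) * (G / S - γ / μ) := by ring
  rw [e]
  refine (abs_add_le _ _).trans (add_le_add ?_ ?_)
  · rw [abs_mul, abs_of_nonneg (sq_nonneg (G / S))]
    exact mul_le_of_le_one_right (abs_nonneg _) (pow_le_one₀ hb0 hb1)
  · rw [abs_mul, abs_of_nonneg (by positivity)]
    exact mul_le_mul (by nlinarith) h1 (abs_nonneg _) zero_le_two

lemma mainWork_div (hd : ∀ v, 1 ≤ (d : Fin n → ℕ) v) (K : ℕ) :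
    mainWork d K / n = ∑ t ∈ Finset.Icc 1 K, ((t : ℝ) * (t - 1)) *
      ((∑ u, if d u = t then (1 : ℝ) else 0) / n *
        ((∑ u, if t ≤ d u then (d u : ℝ) else 0) / n / ((∑ u, (d u : ℝ)) / n)) ^ 2) := by
  rcases Nat.eq_zero_or_pos n with rfl | hn
  · simp [mainWork]
  have hn' : (n : ℝ) ≠ 0 := by positivity
  rw [mainWork, ← Finset.sum_fiberwise_of_maps_to (t := Finset.Icc 1 K) (g := d)
    (fun v hv => Finset.mem_Icc.2 ⟨hd v, (Finset.mem_filter.1 hv).2⟩), Finset.sum_div]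
  refine Finset.sum_congr rfl fun t ht => ?_
  have htK := (Finset.mem_Icc.1 ht).2
  have e : ((Finset.univ.filter fun v => d v ≤ K).filter fun v => d v = t) =
      Finset.univ.filter fun v => d v = t := by
    ext v
    simp only [Finset.mem_filter, Finset.mem_univ, true_and]
    constructor
    · exact fun h => h.2
    · exact fun h => ⟨h ▸ htK, h⟩
  rw [e, div_div_div_cancel_right₀ hn', ← degSum_eq_sum d fun s => t ≤ s, ← Finset.sum_filter,
    Finset.sum_congr rfl (g := fun _ => (t : ℝ) * (t - 1) *
      (degSum d (fun u => t ≤ d u) / degSum d fun _ => True) ^ 2)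
      fun v hv => by rw [(Finset.mem_filter.1 hv).2]]
  rw [degSum_eq (fun _ => True)]
  simp only [Finset.sum_const, nsmul_eq_mul, mul_one, Finset.filter_true]
  ring

lemma iidMean_mainWork_le {M : ℕ} (hp : ∀ t ∈ Finset.Icc 1 M, 0 ≤ p t)
    (hn : 0 < n) (K : ℕ) {φ γ : ℕ → ℝ} {μ : ℝ} (hφ0 : ∀ t, 0 ≤ φ t) (hφ1 : ∀ t, φ t ≤ 1)
    (hγ0 : ∀ t, 0 ≤ γ t) (hγμ : ∀ t, γ t ≤ μ) (hμ : 0 < μ) :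
    iidMean (Finset.Icc 1 M) p (fun d : Fin n → ℕ => |mainWork d K / n -
        ∑ t ∈ Finset.Icc 1 K, ((t : ℝ) * (t - 1)) * (φ t * (γ t / μ) ^ 2)|) ≤
      ∑ t ∈ Finset.Icc 1 K, ((t : ℝ) * (t - 1)) *
        (iidMean (Finset.Icc 1 M) p (fun d : Fin n → ℕ =>
          |(∑ u, if d u = t then (1 : ℝ) else 0) / n - φ t|) +
        2 * (iidMean (Finset.Icc 1 M) p (fun d : Fin n → ℕ =>
          |(∑ u, if t ≤ d u then (d u : ℝ) else 0) / n - γ t|) +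
        iidMean (Finset.Icc 1 M) p (fun d : Fin n → ℕ => |(∑ u, (d u : ℝ)) / n - μ|))) := by
  have hn' : (0 : ℝ) < n := by exact_mod_cast hn
  simp only [← iidMean_add, ← iidMean_const_mul, ← iidMean_sum]
  refine iidMean_mono hp fun d hd => ?_
  have hd1 : ∀ v, 1 ≤ d v := fun v => (Finset.mem_Icc.1 (hd v)).1
  rw [mainWork_div hd1, ← Finset.sum_sub_distrib]
  refine (Finset.abs_sum_le_sum_abs _ _).trans (Finset.sum_le_sum fun t ht => ?_)
  have ht0 : (0 : ℝ) ≤ (t : ℝ) * (t - 1) := nat_mul_pred_nonneg t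
  rw [← mul_sub, abs_mul, abs_of_nonneg ht0]
  refine mul_le_mul_of_nonneg_left ?_ ht0
  refine abs_mul_sq_ratio_sub_le (hφ0 t) (hφ1 t) ?_ ?_ ?_ (hγ0 t) (hγμ t) hμ
  · exact div_nonneg (Finset.sum_nonneg fun u _ => by split_ifs <;> positivity) hn'.le
  · refine div_le_div_of_nonneg_right (Finset.sum_le_sum fun u _ => ?_) hn'.le
    split_ifs
    · exact le_rfl
    · positivity
  · rw [le_div_iff₀ hn', one_mul]
    simpa [degSum_eq] using le_degSum_true hd1

end Sampling

section HighDegrees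

variable {n : ℕ}

lemma rpow_four_thirds {x : ℝ} (hx : 0 ≤ x) : x ^ ((4 : ℝ) / 3) = x * x ^ ((1 : ℝ) / 3) := by
  rcases hx.eq_or_lt with rfl | h
  · rw [zero_mul, Real.zero_rpow (by norm_num)]
  · rw [show (4 : ℝ) / 3 = 1 + 1 / 3 by norm_num, Real.rpow_add h, Real.rpow_one]

lemma le_rpow_four_thirds (t : ℕ) : (t : ℝ) ≤ (t : ℝ) ^ ((4 : ℝ) / 3) := by
  rcases Nat.eq_zero_or_pos t with rfl | h
  · simp
  · have h1 : (1 : ℝ) ≤ t := by exact_mod_cast h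
    exact Real.self_le_rpow_of_one_le h1 (by norm_num)

lemma rpow_third_mul_le {a b : ℕ} (h : a ≤ 2 * b) :
    (a : ℝ) ^ ((1 : ℝ) / 3) * b ≤ 2 * (b : ℝ) ^ ((4 : ℝ) / 3) := by
  rw [rpow_four_thirds (Nat.cast_nonneg b)]
  have h1 : (a : ℝ) ^ ((1 : ℝ) / 3) ≤ 2 * (b : ℝ) ^ ((1 : ℝ) / 3) := by
    have h2 : (a : ℝ) ≤ 2 * b := by exact_mod_cast h
    refine (Real.rpow_le_rpow (Nat.cast_nonneg a) h2 (by norm_num)).trans ?_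
    rw [Real.mul_rpow zero_le_two (Nat.cast_nonneg b)]
    refine mul_le_mul_of_nonneg_right ?_ (by positivity)
    exact Real.rpow_le_self_of_one_le one_le_two (by norm_num)
  calc _ ≤ 2 * (b : ℝ) ^ ((1 : ℝ) / 3) * b := by gcongr
    _ = _ := by ring

lemma sq_mul_degSum_sq_le (d : Fin n → ℕ) (v : Fin n) :
    (d v : ℝ) ^ 2 * (degSum d fun u => u ≠ v ∧ d v ≤ 2 * d u) ^ 2 ≤
      4 * ((d v : ℝ) ^ ((4 : ℝ) / 3) *
        (∑ u ∈ Finset.univ.erase v, (d u : ℝ) ^ ((4 : ℝ) / 3)) ^ 2) := by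
  have hx : (0 : ℝ) ≤ d v := Nat.cast_nonneg _
  set a := (d v : ℝ) ^ ((1 : ℝ) / 3) with ha
  have ha0 : 0 ≤ a := by positivity
  have e : (d v : ℝ) ^ 2 = (d v : ℝ) ^ ((4 : ℝ) / 3) * a ^ 2 := by
    rw [rpow_four_thirds hx, ← ha]
    have h3 : a ^ 3 = d v := by
      rw [ha, ← Real.rpow_natCast, ← Real.rpow_mul hx]
      norm_num
    calc (d v : ℝ) ^ 2 = d v * a ^ 3 := by rw [h3, sq]
      _ = _ := by ring
  have h1 : a * (degSum d fun u => u ≠ v ∧ d v ≤ 2 * d u) ≤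
      2 * ∑ u ∈ Finset.univ.erase v, (d u : ℝ) ^ ((4 : ℝ) / 3) := by
    rw [degSum_eq, Finset.mul_sum, Finset.mul_sum]
    refine (Finset.sum_le_sum fun u hu => rpow_third_mul_le
      (Finset.mem_filter.1 hu).2.2).trans (Finset.sum_le_sum_of_subset_of_nonneg ?_ ?_)
    · intro u hu
      exact Finset.mem_erase.2 ⟨(Finset.mem_filter.1 hu).2.1, Finset.mem_univ _⟩
    · intro u _ _
      positivity
  have h2 := pow_le_pow_left₀ (mul_nonneg ha0 (degSum_nonneg _)) h1 2
  rw [e]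
  calc _ = (d v : ℝ) ^ ((4 : ℝ) / 3) *
        (a * (degSum d fun u => u ≠ v ∧ d v ≤ 2 * d u)) ^ 2 := by ring
    _ ≤ (d v : ℝ) ^ ((4 : ℝ) / 3) *
        (2 * ∑ u ∈ Finset.univ.erase v, (d u : ℝ) ^ ((4 : ℝ) / 3)) ^ 2 := by gcongr
    _ = _ := by ring

lemma bad_indicator_le (hn : 0 < n) (d : Fin n → ℕ) (v : Fin n) (K₀ : ℕ) {c : ℝ}
    (hc : c ≤ 1 / 16) :
    (if (n : ℝ) / 8 ≤ degSum d (fun u => K₀ < d u) then (d v : ℝ) ^ 2 else 0) ≤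
      256 / (n : ℝ) ^ 2 *
        ((d v : ℝ) ^ 2 * (∑ u, ((if K₀ < d u then (d u : ℝ) else 0) - c)) ^ 2) := by
  have hn' : (0 : ℝ) < n := by exact_mod_cast hn
  split_ifs with h
  · have h1 : (n : ℝ) / 16 ≤ ∑ u, ((if K₀ < d u then (d u : ℝ) else 0) - c) := by
      rw [Finset.sum_sub_distrib, ← degSum_eq_sum d fun s => K₀ < s]
      simp only [Finset.sum_const, Finset.card_univ, Fintype.card_fin, nsmul_eq_mul]
      nlinarith
    have h2 := pow_le_pow_left₀ (by positivity) h1 2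
    calc (d v : ℝ) ^ 2 = 256 / (n : ℝ) ^ 2 * ((d v : ℝ) ^ 2 * ((n : ℝ) / 16) ^ 2) := by
          field_simp; norm_num
      _ ≤ _ := by gcongr
  · positivity

lemma highError_le (hn : 0 < n) (d : Fin n → ℕ) (v : Fin n) (K₀ K : ℕ) {c : ℝ}
    (hc : c ≤ 1 / 16) :
    (if K < d v then highError d K₀ v else 0) ≤
      16 / (n : ℝ) ^ 2 * ((if K < d v then (d v : ℝ) ^ ((4 : ℝ) / 3) else 0) *
        (∑ u ∈ Finset.univ.erase v, (d u : ℝ) ^ ((4 : ℝ) / 3)) ^ 2) +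
      (32 * K₀ / n * (d v : ℝ) ^ 3 +
        512 * (if K < d v then (d v : ℝ) ^ ((4 : ℝ) / 3) else 0)) +
      256 / (n : ℝ) ^ 2 *
        ((d v : ℝ) ^ 2 * (∑ u, ((if K₀ < d u then (d u : ℝ) else 0) - c)) ^ 2) := by
  by_cases h : K < d v
  · simp only [h, if_true, highError]
    refine add_le_add (add_le_add ?_ (add_le_add le_rfl ?_)) (bad_indicator_le hn d v K₀ hc)
    · calc _ ≤ 4 / (n : ℝ) ^ 2 * _ :=
            mul_le_mul_of_nonneg_left (sq_mul_degSum_sq_le d v) (by positivity)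
        _ = _ := by ring
    · exact mul_le_mul_of_nonneg_left (le_rpow_four_thirds _) (by norm_num)
  · simp only [h, if_false]
    positivity

variable {M : ℕ} {p : ℕ → ℝ}

lemma wMean_pow_le (hp : ∀ t ∈ Finset.Icc 1 M, 0 ≤ p t) (k : ℕ) :
    wMean (Finset.Icc 1 M) p (fun t => (t : ℝ) ^ (k + 1)) ≤
      (M : ℝ) ^ k * wMean (Finset.Icc 1 M) p fun t => (t : ℝ) := by
  rw [← wMean_const_mul]
  refine wMean_mono hp fun t ht => ?_
  have : (t : ℝ) ≤ M := by exact_mod_cast (Finset.mem_Icc.1 ht).2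
  rw [pow_succ]
  gcongr

lemma iidMean_bad_le (hp : ∀ t ∈ Finset.Icc 1 M, 0 ≤ p t)
    (hp1 : ∑ t ∈ Finset.Icc 1 M, p t = 1) (hMn : M ≤ n) (v : Fin n) (K₀ : ℕ) :
    iidMean (Finset.Icc 1 M) p (fun d : Fin n → ℕ => (d v : ℝ) ^ 2 *
      (∑ u, ((if K₀ < d u then (d u : ℝ) else 0) -
        wMean (Finset.Icc 1 M) p fun t => if K₀ < t then (t : ℝ) else 0)) ^ 2) ≤
      2 * (n * (M : ℝ) ^ 2 * ((wMean (Finset.Icc 1 M) p fun t => (t : ℝ)) +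
        (wMean (Finset.Icc 1 M) p fun t => (t : ℝ)) ^ 2)) := by
  set g : ℕ → ℝ := fun t => if K₀ < t then (t : ℝ) else 0 with hg
  set c := wMean (Finset.Icc 1 M) p g with hc
  set m₁ := wMean (Finset.Icc 1 M) p fun t => (t : ℝ) with hm₁
  have hm0 : 0 ≤ m₁ := wMean_nonneg hp fun t _ => Nat.cast_nonneg t
  have hMn' : (M : ℝ) ≤ n := by exact_mod_cast hMn
  have hg0 : ∀ t, 0 ≤ g t := fun t => by simp only [hg]; split_ifs <;> positivity
  have hgt : ∀ t, g t ≤ t := fun t => by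
    simp only [hg]
    split_ifs
    · exact le_rfl
    · positivity
  have hgM : ∀ t ∈ Finset.Icc 1 M, g t ≤ M := fun t ht =>
    (hgt t).trans (by exact_mod_cast (Finset.mem_Icc.1 ht).2)
  have hc0 : 0 ≤ c := wMean_nonneg hp fun t _ => hg0 t
  have hcM : c ≤ M := (wMean_mono hp hgM).trans_eq (wMean_const hp1 _)
  refine (iidMean_mul_sq_centred_le hp hp1 v (g := fun t => (t : ℝ) ^ 2) (fun t _ => sq_nonneg _)
    (wMean_sub_mean hp1 g)).trans ?_
  have h2 : wMean (Finset.Icc 1 M) p (fun t => (t : ℝ) ^ 2) ≤ M * m₁ := by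
    simpa using wMean_pow_le hp 1
  have h20 : 0 ≤ wMean (Finset.Icc 1 M) p (fun t => (t : ℝ) ^ 2) :=
    wMean_nonneg hp fun t _ => sq_nonneg _
  have h3 : wMean (Finset.Icc 1 M) p (fun t => (t : ℝ) ^ 2 * (g t - c) ^ 2) ≤
      n * (M : ℝ) ^ 2 * m₁ := by
    have h4 : wMean (Finset.Icc 1 M) p (fun t => (t : ℝ) ^ 2 * (g t - c) ^ 2) ≤
        wMean (Finset.Icc 1 M) p (fun t => (M : ℝ) ^ 2 * (t : ℝ) ^ 2) := by
      refine wMean_mono hp fun t ht => ?_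
      rw [mul_comm]
      refine mul_le_mul_of_nonneg_right ?_ (sq_nonneg _)
      refine sq_le_sq' ?_ ?_ <;> linarith [hg0 t, hgM t ht]
    rw [wMean_const_mul] at h4
    calc _ ≤ _ := h4
      _ ≤ (M : ℝ) ^ 2 * (M * m₁) := by gcongr
      _ ≤ (M : ℝ) ^ 2 * (n * m₁) := by gcongr
      _ = _ := by ring
  have h5 : wMean (Finset.Icc 1 M) p (fun t => (g t - c) ^ 2) ≤ M * m₁ := by
    refine (wMean_sq_sub_le hp1 g).trans (le_trans (wMean_mono hp fun t _ => ?_) h2)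
    exact pow_le_pow_left₀ (hg0 t) (hgt t) 2
  have h50 : 0 ≤ wMean (Finset.Icc 1 M) p (fun t => (g t - c) ^ 2) :=
    wMean_nonneg hp fun t _ => sq_nonneg _
  have h6 : wMean (Finset.Icc 1 M) p (fun t => (t : ℝ) ^ 2) *
      (n * wMean (Finset.Icc 1 M) p (fun t => (g t - c) ^ 2)) ≤ (M * m₁) * (n * (M * m₁)) := by
    gcongr
  calc _ ≤ 2 * (n * (M : ℝ) ^ 2 * m₁) + 2 * ((M * m₁) * (n * (M * m₁))) := by
        linarith
    _ = _ := by ring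

lemma iidMean_highError_le (hp : ∀ t ∈ Finset.Icc 1 M, 0 ≤ p t)
    (hp1 : ∑ t ∈ Finset.Icc 1 M, p t = 1) (hMn : M ≤ n) (v : Fin n) (K₀ K : ℕ)
    (hK₀ : wMean (Finset.Icc 1 M) p (fun t => if K₀ < t then (t : ℝ) else 0) ≤ 1 / 16)
    {δ m₁ m τ : ℝ} (hδ : δ = (M : ℝ) ^ 2 / n) (hm₁ : m₁ = wMean (Finset.Icc 1 M) p fun t => (t : ℝ))
    (hm : m = wMean (Finset.Icc 1 M) p fun t => (t : ℝ) ^ ((4 : ℝ) / 3))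
    (hτ : τ = wMean (Finset.Icc 1 M) p fun t => if K < t then (t : ℝ) ^ ((4 : ℝ) / 3) else 0) :
    iidMean (Finset.Icc 1 M) p (fun d : Fin n → ℕ => if K < d v then highError d K₀ v else 0) ≤
      16 * (τ * (δ * m + m ^ 2)) + (32 * K₀ * (δ * m₁) + 512 * τ) + 512 * (δ * (m₁ + m₁ ^ 2)) := by
  have hn : 0 < n := v.pos
  have hn' : (0 : ℝ) < n := by exact_mod_cast hn
  refine (iidMean_mono hp fun d _ => highError_le hn d v K₀ K hK₀).trans ?_
  have hm0 : 0 ≤ m := hm ▸ wMean_nonneg hp fun t _ => by positivity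
  have hτ0 : 0 ≤ τ := hτ ▸ wMean_nonneg hp fun t _ => by split_ifs <;> positivity
  have h1 := iidMean_mul_sq_sum_le hp hp1 v
    (g := fun t => if K < t then (t : ℝ) ^ ((4 : ℝ) / 3) else 0)
    (fun t _ => by split_ifs <;> positivity) fun t => (t : ℝ) ^ ((4 : ℝ) / 3)
  rw [← hτ, ← hm] at h1
  have h2 : wMean (Finset.Icc 1 M) p (fun t => ((t : ℝ) ^ ((4 : ℝ) / 3)) ^ 2) ≤
      (M : ℝ) ^ 2 * m := by
    rw [hm, ← wMean_const_mul]
    refine wMean_mono hp fun t ht => ?_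
    rw [sq]
    refine mul_le_mul_of_nonneg_right ?_ (by positivity)
    have ht1 : (1 : ℝ) ≤ t := by exact_mod_cast (Finset.mem_Icc.1 ht).1
    have htM : (t : ℝ) ≤ M := by exact_mod_cast (Finset.mem_Icc.1 ht).2
    calc (t : ℝ) ^ ((4 : ℝ) / 3) ≤ (t : ℝ) ^ (2 : ℝ) :=
          Real.rpow_le_rpow_of_exponent_le ht1 (by norm_num)
      _ = (t : ℝ) ^ 2 := Real.rpow_two _
      _ ≤ _ := by gcongr
  have h3 : wMean (Finset.Icc 1 M) p (fun t => (t : ℝ) ^ 3) ≤ (M : ℝ) ^ 2 * m₁ :=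
    hm₁ ▸ wMean_pow_le hp 2
  have h4 := iidMean_bad_le hp hp1 hMn v K₀
  rw [← hm₁] at h4
  rw [iidMean_add, iidMean_add, iidMean_add, iidMean_const_mul, iidMean_const_mul,
    iidMean_const_mul, iidMean_const_mul, iidMean_one hp1 v fun t => (t : ℝ) ^ 3,
    iidMean_one hp1 v fun t => if K < t then (t : ℝ) ^ ((4 : ℝ) / 3) else 0, ← hτ]
  refine add_le_add (add_le_add ?_ (add_le_add ?_ le_rfl)) ?_
  · calc _ ≤ 16 / (n : ℝ) ^ 2 * (τ * (n * ((M : ℝ) ^ 2 * m) + n ^ 2 * m ^ 2)) :=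
          mul_le_mul_of_nonneg_left (h1.trans (by gcongr)) (by positivity)
      _ = _ := by rw [hδ]; field_simp
  · calc _ ≤ 32 * K₀ / n * ((M : ℝ) ^ 2 * m₁) := by gcongr
      _ = _ := by rw [hδ]; field_simp
  · calc _ ≤ 256 / (n : ℝ) ^ 2 * (2 * (n * (M : ℝ) ^ 2 * (m₁ + m₁ ^ 2))) :=
          mul_le_mul_of_nonneg_left h4 (by positivity)
      _ = _ := by rw [hδ]; field_simp; ring

end HighDegrees

section FiniteSize

lemma abs_iidMean_ecmWork_sub_le {n M : ℕ} {p : ℕ → ℝ} (hp : ∀ t ∈ Finset.Icc 1 M, 0 ≤ p t)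
    (hp1 : ∑ t ∈ Finset.Icc 1 M, p t = 1) (hn : 8 ≤ n) (hMn : M + 4 ≤ n) {K₀ K J : ℕ}
    (hK : 12 ≤ K) (hK₀K : K₀ ≤ K) (hKJ : K ≤ J)
    (hK₀ : wMean (Finset.Icc 1 M) p (fun t => if K₀ < t then (t : ℝ) else 0) ≤ 1 / 16)
    {δ m₁ m τ : ℝ} (hδ : δ = (M : ℝ) ^ 2 / n) (hm₁ : m₁ = wMean (Finset.Icc 1 M) p fun t => (t : ℝ))
    (hm : m = wMean (Finset.Icc 1 M) p fun t => (t : ℝ) ^ ((4 : ℝ) / 3))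
    (hτ : τ = wMean (Finset.Icc 1 M) p fun t => if K < t then (t : ℝ) ^ ((4 : ℝ) / 3) else 0)
    (L : ℝ) :
    |2 * iidMean (Finset.Icc 1 M) p (fun d : Fin n → ℕ => ecmWork d) / n - L| ≤
      iidMean (Finset.Icc 1 M) p (fun d : Fin n → ℕ => |mainWork d K / n - L|) +
      ((K : ℝ) ^ 2 * ((1 + J) * ((1 + (J : ℝ) ^ 2 * 2) / n + (J : ℝ) ^ 2 * 4 * δ) +
        wMean (Finset.Icc 1 M) p fun t => if J < t then (t : ℝ) else 0) +
      (K : ℝ) ^ 2 * (2 * K + 24) / n +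
      (16 * (τ * (δ * m + m ^ 2)) + (32 * K₀ * (δ * m₁) + 512 * τ) +
        512 * (δ * (m₁ + m₁ ^ 2)))) := by
  have hn' : (0 : ℝ) < n := by positivity
  have e : 2 * iidMean (Finset.Icc 1 M) p (fun d : Fin n → ℕ => ecmWork d) / n - L =
      iidMean (Finset.Icc 1 M) p fun d : Fin n → ℕ => 2 / (n : ℝ) * ecmWork d - L := by
    rw [iidMean_sub, iidMean_const_mul, iidMean_const hp1]
    ring
  set H := 16 * (τ * (δ * m + m ^ 2)) + (32 * K₀ * (δ * m₁) + 512 * τ) +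
    512 * (δ * (m₁ + m₁ ^ 2)) with hH
  have hpt : iidMean (Finset.Icc 1 M) p (fun d : Fin n → ℕ => |2 / (n : ℝ) * ecmWork d - L|) ≤
      iidMean (Finset.Icc 1 M) p fun d : Fin n → ℕ => |mainWork d K / n - L| + 1 / n *
        (((K : ℝ) ^ 2 * ((1 + J) * (1 + (J : ℝ) ^ 2 * (2 + 4 * M))) + (K : ℝ) ^ 2 * (2 * K + 24)) +
        ((K : ℝ) ^ 2 * (∑ u, if J < d u then (d u : ℝ) else 0) +
        ∑ v, if K < d v then highError d K₀ v else 0)) := by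
    refine iidMean_mono hp fun d hd => ?_
    have h1 := abs_ecmWork_sub_mainWork_le hn (fun v => (Finset.mem_Icc.1 (hd v)).1)
      (fun v => (Finset.mem_Icc.1 (hd v)).2) hMn hK hK₀K hKJ
    rw [degSum_eq_sum d fun s => J < s, Finset.sum_filter] at h1
    have e2 : 2 / (n : ℝ) * ecmWork d - L =
        (mainWork d K / n - L) + 1 / n * (2 * ecmWork d - mainWork d K) := by
      field_simp
      ring
    rw [e2]
    refine (abs_add_le _ _).trans (add_le_add le_rfl ?_)
    rw [abs_mul, abs_of_nonneg (by positivity : (0 : ℝ) ≤ 1 / n)]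
    refine mul_le_mul_of_nonneg_left (h1.trans (le_of_eq ?_)) (by positivity)
    ring
  have hhigh : iidMean (Finset.Icc 1 M) p
      (fun d : Fin n → ℕ => ∑ v, if K < d v then highError d K₀ v else 0) ≤ n * H := by
    rw [iidMean_sum]
    refine (Finset.sum_le_sum fun v _ =>
      iidMean_highError_le hp hp1 (by omega) v K₀ K hK₀ hδ hm₁ hm hτ).trans (le_of_eq ?_)
    rw [Finset.sum_const, Finset.card_univ, Fintype.card_fin, nsmul_eq_mul]
  have hJ : iidMean (Finset.Icc 1 M) p
      (fun d : Fin n → ℕ => ∑ u, if J < d u then (d u : ℝ) else 0) =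
      n * wMean (Finset.Icc 1 M) p fun t => if J < t then (t : ℝ) else 0 := by
    rw [iidMean_sum]
    refine (Finset.sum_congr rfl fun u _ =>
      iidMean_one hp1 u fun t => if J < t then (t : ℝ) else 0).trans ?_
    simp
  have hM : (M : ℝ) / n ≤ δ := by
    rw [hδ]
    refine div_le_div_of_nonneg_right ?_ hn'.le
    exact_mod_cast Nat.le_self_pow two_ne_zero M
  rw [e]
  refine (abs_iidMean_le hp _).trans (hpt.trans ?_)
  rw [iidMean_add, iidMean_const_mul, iidMean_add, iidMean_const hp1, iidMean_add,
    iidMean_const_mul, hJ]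
  refine add_le_add le_rfl ?_
  set T := wMean (Finset.Icc 1 M) p fun t => if J < t then (t : ℝ) else 0
  calc _ ≤ 1 / (n : ℝ) *
        (((K : ℝ) ^ 2 * ((1 + J) * (1 + (J : ℝ) ^ 2 * (2 + 4 * M))) + (K : ℝ) ^ 2 * (2 * K + 24)) +
        ((K : ℝ) ^ 2 * (n * T) + n * H)) := by gcongr
    _ = (K : ℝ) ^ 2 * ((1 + J) * ((1 + (J : ℝ) ^ 2 * 2) / n + (J : ℝ) ^ 2 * 4 * (M / n)) + T) +
        (K : ℝ) ^ 2 * (2 * K + 24) / n + H := by field_simp; ring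
    _ ≤ _ := by gcongr

end FiniteSize

section Truncation

lemma tendsto_sqrt_div_log_sq :
    Filter.Tendsto (fun n : ℕ => √(n : ℝ) / Real.log n ^ 2) Filter.atTop Filter.atTop := by
  have h := (isLittleO_log_rpow_rpow_atTop (s := 1 / 2) 2 (by norm_num)).tendsto_div_nhds_zero
  have h1 : Filter.Tendsto (fun x : ℝ => Real.log x ^ (2 : ℝ) / x ^ ((1 : ℝ) / 2)) Filter.atTop
      (nhdsWithin 0 (Set.Ioi 0)) := by
    refine tendsto_nhdsWithin_iff.2 ⟨h, ?_⟩
    filter_upwards [Filter.eventually_gt_atTop 1] with x hx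
    have := Real.log_pos hx
    exact Set.mem_Ioi.2 (by positivity)
  refine ((Filter.Tendsto.inv_tendsto_nhdsGT_zero h1).comp
    tendsto_natCast_atTop_atTop).congr fun n => ?_
  simp [Real.sqrt_eq_rpow]

lemma tendsto_degCap : Filter.Tendsto degCap Filter.atTop Filter.atTop :=
  tendsto_nat_floor_atTop.comp tendsto_sqrt_div_log_sq

lemma tendsto_degCap_sq_div :
    Filter.Tendsto (fun n : ℕ => (degCap n : ℝ) ^ 2 / n) Filter.atTop (nhds 0) := by
  have h : Filter.Tendsto (fun n : ℕ => ((Real.log n) ^ 4)⁻¹) Filter.atTop (nhds 0) :=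
    ((Filter.tendsto_pow_atTop four_ne_zero).comp
      (Real.tendsto_log_atTop.comp tendsto_natCast_atTop_atTop)).inv_tendsto_atTop
  refine squeeze_zero (fun n => by positivity) (fun n => ?_) h
  rcases Nat.eq_zero_or_pos n with rfl | hn
  · simp
  have hn' : (0 : ℝ) < n := by exact_mod_cast hn
  have h1 : (degCap n : ℝ) ≤ √n / Real.log n ^ 2 := Nat.floor_le (by positivity)
  rw [div_le_iff₀ hn']
  calc (degCap n : ℝ) ^ 2 ≤ (√n / Real.log n ^ 2) ^ 2 := by gcongr
    _ = _ := by rw [div_pow, Real.sq_sqrt hn'.le, ← pow_mul]; ring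

lemma eventually_degCap_add_le : ∀ᶠ n in Filter.atTop, degCap n + 4 ≤ n := by
  filter_upwards [tendsto_degCap_sq_div.eventually_le_const zero_lt_one,
    Filter.eventually_ge_atTop 8] with n h hn
  have hn' : (8 : ℝ) ≤ n := by exact_mod_cast hn
  rw [div_le_one (by linarith)] at h
  by_contra! hlt
  have h1 : (n : ℝ) < degCap n + 4 := by exact_mod_cast hlt
  have h2 : (n : ℝ) + 1 ≤ degCap n + 4 := by exact_mod_cast hlt
  nlinarith

/-- The mass function `f` conditioned on `{1, …, degCap n}`. -/
def capLaw (f : ℕ → ℝ) (n t : ℕ) : ℝ := f t / ∑ s ∈ Finset.Icc 1 (degCap n), f s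

lemma expectedWork_eq (f : ℕ → ℝ) (n : ℕ) :
    expectedWork f n = iidMean (Finset.Icc 1 (degCap n)) (capLaw f n)
      fun d : Fin n → ℕ => ecmWork d := by
  simp only [expectedWork, iidMean, capLaw, Finset.prod_div_distrib, Finset.prod_const,
    Finset.card_univ, Fintype.card_fin]

lemma tendsto_sum_Icc_one {a : ℕ → ℝ} (ha : Summable a) (h0 : a 0 = 0) :
    Filter.Tendsto (fun N => ∑ t ∈ Finset.Icc 1 N, a t) Filter.atTop (nhds (∑' t, a t)) := by
  refine (ha.hasSum.tendsto_sum_nat.comp (Filter.tendsto_add_atTop_nat 1)).congr fun N => ?_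
  simp only [Function.comp]
  rw [Finset.range_eq_Ico, Finset.sum_eq_sum_Ico_succ_bot (Nat.succ_pos N), h0, zero_add]
  rfl

variable {f : ℕ → ℝ}

lemma tendsto_wMean_capLaw (hf00 : f 0 = 0) (hfsum : HasSum f 1) {g : ℕ → ℝ}
    (hg : Summable fun t => f t * g t) :
    Filter.Tendsto (fun n => wMean (Finset.Icc 1 (degCap n)) (capLaw f n) g) Filter.atTop
      (nhds (∑' t, f t * g t)) := by
  have h1 := (tendsto_sum_Icc_one hg (by rw [hf00, zero_mul])).comp tendsto_degCap
  have h2 := (tendsto_sum_Icc_one hfsum.summable hf00).comp tendsto_degCap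
  rw [hfsum.tsum_eq] at h2
  have h3 := h1.div h2 one_ne_zero
  rw [div_one] at h3
  refine h3.congr fun n => ?_
  simp only [wMean, capLaw, Function.comp, Pi.div_apply, Finset.sum_div]
  exact Finset.sum_congr rfl fun t _ => by ring

lemma capLaw_nonneg (hf0 : ∀ t, 0 ≤ f t) (n t : ℕ) : 0 ≤ capLaw f n t :=
  div_nonneg (hf0 t) (Finset.sum_nonneg fun s _ => hf0 s)

lemma eventually_sum_capLaw (hf00 : f 0 = 0) (hfsum : HasSum f 1) :
    ∀ᶠ n in Filter.atTop, ∑ t ∈ Finset.Icc 1 (degCap n), capLaw f n t = 1 := by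
  have h2 := (tendsto_sum_Icc_one hfsum.summable hf00).comp tendsto_degCap
  rw [hfsum.tsum_eq] at h2
  filter_upwards [h2.eventually (lt_mem_nhds zero_lt_one)] with n hn
  simp only [Function.comp] at hn
  simp only [capLaw]
  rw [← Finset.sum_div, div_self hn.ne']

lemma tendsto_iidMean_abs_avg_sub (hf0 : ∀ t, 0 ≤ f t) (hf00 : f 0 = 0) (hfsum : HasSum f 1)
    (hmean : Summable fun t : ℕ => f t * (t : ℝ)) {g : ℕ → ℝ} (hg0 : ∀ t, 0 ≤ g t)
    (hgt : ∀ t : ℕ, 1 ≤ t → g t ≤ t) (hg : Summable fun t => f t * g t) :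
    Filter.Tendsto (fun n => iidMean (Finset.Icc 1 (degCap n)) (capLaw f n)
      (fun d : Fin n → ℕ => |(∑ u, g (d u)) / n - ∑' t, f t * g t|)) Filter.atTop (nhds 0) := by
  have h1 := tendsto_wMean_capLaw hf00 hfsum hg
  have h2 := tendsto_wMean_capLaw hf00 hfsum hmean
  have h3 : Filter.Tendsto (fun n : ℕ =>
      |wMean (Finset.Icc 1 (degCap n)) (capLaw f n) g - ∑' t, f t * g t| +
      √(4 * ((degCap n : ℝ) ^ 2 / n *
        wMean (Finset.Icc 1 (degCap n)) (capLaw f n) fun t => (t : ℝ)))) Filter.atTop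
      (nhds 0) := by
    have h4 := (h1.sub_const (∑' t, f t * g t)).abs.add
      ((tendsto_degCap_sq_div.mul h2).const_mul 4).sqrt
    simpa using h4
  refine squeeze_zero' (Filter.Eventually.of_forall fun n => ?_) ?_ h3
  · exact Finset.sum_nonneg fun d _ =>
      mul_nonneg (Finset.prod_nonneg fun i _ => capLaw_nonneg hf0 n _) (abs_nonneg _)
  · filter_upwards [eventually_sum_capLaw hf00 hfsum, Filter.eventually_gt_atTop 0] with n hn hn0
    have hp : ∀ t ∈ Finset.Icc 1 (degCap n), 0 ≤ capLaw f n t := fun t _ => capLaw_nonneg hf0 n t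
    refine (iidMean_abs_avg_sub_le hp hn hn0 g _).trans
      (add_le_add le_rfl (Real.sqrt_le_sqrt ?_))
    rw [mul_div_assoc, div_mul_eq_mul_div]
    have h5 : wMean (Finset.Icc 1 (degCap n)) (capLaw f n) (fun t => g t ^ 2) ≤
        (degCap n : ℝ) ^ 2 * wMean (Finset.Icc 1 (degCap n)) (capLaw f n) fun t => (t : ℝ) := by
      refine le_trans (wMean_mono hp fun t ht => ?_) (wMean_pow_le hp 2)
      have ht1 := (Finset.mem_Icc.1 ht).1
      have h6 : (1 : ℝ) ≤ t := by exact_mod_cast ht1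
      calc g t ^ 2 ≤ (t : ℝ) ^ 2 := pow_le_pow_left₀ (hg0 t) (hgt t ht1) 2
        _ ≤ (t : ℝ) ^ 3 := pow_le_pow_right₀ h6 (by norm_num)
    gcongr

end Truncation

section Limit

variable {f : ℕ → ℝ}

/-- The part of the mean of `f` carried by degrees at least `t`. -/
def upperMean (f : ℕ → ℝ) (t : ℕ) : ℝ := ∑' s : ℕ, f s * if t ≤ s then (s : ℝ) else 0

lemma summable_mul_of_le (hf0 : ∀ t, 0 ≤ f t) {g h : ℕ → ℝ} (hh : Summable fun t => f t * h t)
    (hg0 : ∀ t, 0 ≤ g t) (hgh : ∀ t, g t ≤ h t) : Summable fun t => f t * g t :=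
  hh.of_nonneg_of_le (fun t => mul_nonneg (hf0 t) (hg0 t))
    fun t => mul_le_mul_of_nonneg_left (hgh t) (hf0 t)

lemma ite_le_nonneg_le (P : Prop) [Decidable P] {x : ℝ} (hx : 0 ≤ x) :
    0 ≤ (if P then x else 0) ∧ (if P then x else 0) ≤ x := by
  split_ifs
  · exact ⟨hx, le_rfl⟩
  · exact ⟨le_rfl, hx⟩

lemma tendsto_tsum_tail (hf0 : ∀ t, 0 ≤ f t) {h : ℕ → ℝ} (hh0 : ∀ t, 0 ≤ h t)
    (hh : Summable fun t => f t * h t) :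
    Filter.Tendsto (fun K : ℕ => ∑' t, f t * if K < t then h t else 0) Filter.atTop (nhds 0) := by
  have h1 := tendsto_tsum_of_dominated_convergence (𝓕 := Filter.atTop)
    (f := fun K t : ℕ => f t * if K < t then h t else 0) (g := fun _ : ℕ => (0 : ℝ)) hh
    (fun t => tendsto_const_nhds.congr' ?_) (Filter.Eventually.of_forall fun K t => ?_)
  · simpa using h1
  · filter_upwards [Filter.eventually_ge_atTop t] with K hK
    rw [if_neg (by omega), mul_zero]
  · have := ite_le_nonneg_le (K < t) (hh0 t)
    rw [Real.norm_eq_abs, abs_of_nonneg (mul_nonneg (hf0 t) this.1)]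
    exact mul_le_mul_of_nonneg_left this.2 (hf0 t)

lemma upperMean_nonneg (hf0 : ∀ t, 0 ≤ f t) (t : ℕ) : 0 ≤ upperMean f t :=
  tsum_nonneg fun s => mul_nonneg (hf0 s) (ite_le_nonneg_le _ (Nat.cast_nonneg s)).1

lemma summable_upperMean (hf0 : ∀ t, 0 ≤ f t) (hmean : Summable fun t : ℕ => f t * (t : ℝ))
    (t : ℕ) : Summable fun s : ℕ => f s * if t ≤ s then (s : ℝ) else 0 :=
  summable_mul_of_le hf0 hmean (fun s => (ite_le_nonneg_le _ (Nat.cast_nonneg s)).1)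
    fun s => (ite_le_nonneg_le _ (Nat.cast_nonneg s)).2

lemma upperMean_le (hf0 : ∀ t, 0 ≤ f t) (hmean : Summable fun t : ℕ => f t * (t : ℝ)) (t : ℕ) :
    upperMean f t ≤ ∑' s : ℕ, f s * (s : ℝ) :=
  (summable_upperMean hf0 hmean t).tsum_le_tsum
    (fun s => mul_le_mul_of_nonneg_left (ite_le_nonneg_le _ (Nat.cast_nonneg s)).2 (hf0 s)) hmean

lemma rpow_third_mul_upperMean_le (hf0 : ∀ t, 0 ≤ f t)
    (hmean : Summable fun t : ℕ => f t * (t : ℝ))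
    (hmom : Summable fun t : ℕ => f t * (t : ℝ) ^ ((4 : ℝ) / 3)) (t : ℕ) :
    (t : ℝ) ^ ((1 : ℝ) / 3) * upperMean f t ≤ ∑' s : ℕ, f s * (s : ℝ) ^ ((4 : ℝ) / 3) := by
  rw [upperMean, ← tsum_mul_left]
  refine ((summable_upperMean hf0 hmean t).mul_left _).tsum_le_tsum (fun s => ?_) hmom
  rw [mul_left_comm]
  refine mul_le_mul_of_nonneg_left ?_ (hf0 s)
  split_ifs with h
  · rw [rpow_four_thirds (Nat.cast_nonneg s), mul_comm]
    gcongr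
  · rw [mul_zero]
    positivity

lemma one_le_mean (hf0 : ∀ t, 0 ≤ f t) (hf00 : f 0 = 0) (hfsum : HasSum f 1)
    (hmean : Summable fun t : ℕ => f t * (t : ℝ)) : 1 ≤ ∑' t : ℕ, f t * (t : ℝ) := by
  rw [← hfsum.tsum_eq]
  refine hfsum.summable.tsum_le_tsum (fun t => ?_) hmean
  rcases Nat.eq_zero_or_pos t with rfl | h
  · simp [hf00]
  · exact le_mul_of_one_le_right (hf0 t) (by exact_mod_cast h)

lemma summable_upperMean_sq (hf0 : ∀ t, 0 ≤ f t) (hmean : Summable fun t : ℕ => f t * (t : ℝ))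
    (hmom : Summable fun t : ℕ => f t * (t : ℝ) ^ ((4 : ℝ) / 3)) :
    Summable fun t : ℕ => (t : ℝ) * (t - 1) * (f t * upperMean f t ^ 2) := by
  set m := ∑' s : ℕ, f s * (s : ℝ) ^ ((4 : ℝ) / 3) with hm
  refine (hmom.mul_right (m ^ 2)).of_nonneg_of_le (fun t => mul_nonneg (nat_mul_pred_nonneg t)
    (mul_nonneg (hf0 t) (sq_nonneg _))) fun t => ?_
  have h1 := rpow_third_mul_upperMean_le hf0 hmean hmom t
  have hu := upperMean_nonneg hf0 t
  set a := (t : ℝ) ^ ((1 : ℝ) / 3) with ha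
  have ha0 : 0 ≤ a := by positivity
  have h3 : a ^ 3 = t := by
    rw [ha, ← Real.rpow_natCast, ← Real.rpow_mul (Nat.cast_nonneg t)]
    norm_num
  have h2 := pow_le_pow_left₀ (mul_nonneg ha0 hu) h1 2
  have hf := hf0 t
  calc (t : ℝ) * (t - 1) * (f t * upperMean f t ^ 2) ≤
        (t : ℝ) * t * (f t * upperMean f t ^ 2) := by
        gcongr
        linarith
    _ = f t * (t : ℝ) ^ ((4 : ℝ) / 3) * (a * upperMean f t) ^ 2 := by
        rw [rpow_four_thirds (Nat.cast_nonneg t), ← ha]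
        nth_rewrite 2 [← h3]
        ring
    _ ≤ _ := by
        refine mul_le_mul_of_nonneg_left h2 ?_
        positivity

lemma tendsto_iidMean_freq (hf0 : ∀ t, 0 ≤ f t) (hf00 : f 0 = 0) (hfsum : HasSum f 1)
    (hmean : Summable fun t : ℕ => f t * (t : ℝ)) (t : ℕ) :
    Filter.Tendsto (fun n => iidMean (Finset.Icc 1 (degCap n)) (capLaw f n)
      (fun d : Fin n → ℕ => |(∑ u, if d u = t then (1 : ℝ) else 0) / n - f t|))
      Filter.atTop (nhds 0) := by
  have e : ∑' s, f s * (if s = t then (1 : ℝ) else 0) = f t := by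
    rw [tsum_eq_single t fun s hs => by rw [if_neg hs, mul_zero], if_pos rfl, mul_one]
  have h := tendsto_iidMean_abs_avg_sub hf0 hf00 hfsum hmean
    (g := fun s => if s = t then (1 : ℝ) else 0)
    (fun s => (ite_le_nonneg_le _ zero_le_one).1)
    (fun s hs => (ite_le_nonneg_le _ zero_le_one).2.trans (by exact_mod_cast hs))
    (summable_mul_of_le hf0 (h := fun _ => 1) (by simpa using hfsum.summable)
      (fun s => (ite_le_nonneg_le _ zero_le_one).1)
      fun s => (ite_le_nonneg_le _ zero_le_one).2)
  rw [e] at h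
  exact h

lemma tendsto_iidMean_upper (hf0 : ∀ t, 0 ≤ f t) (hf00 : f 0 = 0) (hfsum : HasSum f 1)
    (hmean : Summable fun t : ℕ => f t * (t : ℝ)) (t : ℕ) :
    Filter.Tendsto (fun n => iidMean (Finset.Icc 1 (degCap n)) (capLaw f n)
      (fun d : Fin n → ℕ => |(∑ u, if t ≤ d u then (d u : ℝ) else 0) / n - upperMean f t|))
      Filter.atTop (nhds 0) :=
  tendsto_iidMean_abs_avg_sub hf0 hf00 hfsum hmean
    (g := fun s => if t ≤ s then (s : ℝ) else 0)
    (fun s => (ite_le_nonneg_le _ (Nat.cast_nonneg s)).1)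
    (fun s _ => (ite_le_nonneg_le _ (Nat.cast_nonneg s)).2) (summable_upperMean hf0 hmean t)

lemma tendsto_iidMean_mainWork (hf0 : ∀ t, 0 ≤ f t) (hf00 : f 0 = 0) (hfsum : HasSum f 1)
    (hmean : Summable fun t : ℕ => f t * (t : ℝ)) (K : ℕ) :
    Filter.Tendsto (fun n => iidMean (Finset.Icc 1 (degCap n)) (capLaw f n)
      (fun d : Fin n → ℕ => |mainWork d K / n - ∑ t ∈ Finset.Icc 1 K, ((t : ℝ) * (t - 1)) *
        (f t * (upperMean f t / ∑' s : ℕ, f s * (s : ℝ)) ^ 2)|)) Filter.atTop (nhds 0) := by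
  have hC := tendsto_iidMean_abs_avg_sub hf0 hf00 hfsum hmean (g := fun s => (s : ℝ))
    (fun s => Nat.cast_nonneg s) (fun s _ => le_rfl) hmean
  have hT := tendsto_finsetSum (Finset.Icc 1 K) fun t _ =>
    ((tendsto_iidMean_freq hf0 hf00 hfsum hmean t).add
      (((tendsto_iidMean_upper hf0 hf00 hfsum hmean t).add hC).const_mul 2)).const_mul
        ((t : ℝ) * (t - 1))
  simp only [add_zero, mul_zero, Finset.sum_const_zero] at hT
  refine squeeze_zero' (Filter.Eventually.of_forall fun n => ?_) ?_ hT
  · exact Finset.sum_nonneg fun d _ =>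
      mul_nonneg (Finset.prod_nonneg fun i _ => capLaw_nonneg hf0 n _) (abs_nonneg _)
  · filter_upwards [Filter.eventually_gt_atTop 0] with n hn
    exact iidMean_mainWork_le (fun t _ => capLaw_nonneg hf0 n t) hn K hf0
      (fun t => le_hasSum hfsum t fun s _ => hf0 s) (upperMean_nonneg hf0)
      (upperMean_le hf0 hmean) (zero_lt_one.trans_le (one_le_mean hf0 hf00 hfsum hmean))

lemma eventually_abs_expectedWork_sub_lt (hf0 : ∀ t, 0 ≤ f t) (hf00 : f 0 = 0)
    (hfsum : HasSum f 1) (hmean : Summable fun t : ℕ => f t * (t : ℝ))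
    (hmom : Summable fun t : ℕ => f t * (t : ℝ) ^ ((4 : ℝ) / 3)) {K₀ K J : ℕ}
    (hK : 12 ≤ K) (hK₀K : K₀ ≤ K) (hKJ : K ≤ J)
    (hK₀ : (∑' t : ℕ, f t * if K₀ < t then (t : ℝ) else 0) < 1 / 16) {c : ℝ}
    (hc : (K : ℝ) ^ 2 * (∑' t : ℕ, f t * if J < t then (t : ℝ) else 0) +
      (16 * (∑' t : ℕ, f t * (t : ℝ) ^ ((4 : ℝ) / 3)) ^ 2 + 512) *
        (∑' t : ℕ, f t * if K < t then (t : ℝ) ^ ((4 : ℝ) / 3) else 0) < c) :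
    ∀ᶠ n : ℕ in Filter.atTop, |2 * expectedWork f n / n -
      ∑ t ∈ Finset.Icc 1 K, ((t : ℝ) * (t - 1)) *
        (f t * (upperMean f t / ∑' s : ℕ, f s * (s : ℝ)) ^ 2)| < c := by
  have hsum1 : ∀ J : ℕ, Summable fun t : ℕ => f t * if J < t then (t : ℝ) else 0 := fun J =>
    summable_mul_of_le hf0 hmean (fun s => (ite_le_nonneg_le _ (Nat.cast_nonneg s)).1)
      fun s => (ite_le_nonneg_le _ (Nat.cast_nonneg s)).2
  have hsum2 : Summable fun t : ℕ => f t * if K < t then (t : ℝ) ^ ((4 : ℝ) / 3) else 0 :=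
    summable_mul_of_le hf0 hmom (fun s => (ite_le_nonneg_le _ (by positivity)).1)
      fun s => (ite_le_nonneg_le _ (by positivity)).2
  have hδ := tendsto_degCap_sq_div
  have hm₁ := tendsto_wMean_capLaw hf00 hfsum hmean
  have hm := tendsto_wMean_capLaw hf00 hfsum hmom
  have hτ := tendsto_wMean_capLaw hf00 hfsum hsum2
  have hJ := tendsto_wMean_capLaw hf00 hfsum (hsum1 J)
  have hmain := tendsto_iidMean_mainWork hf0 hf00 hfsum hmean K
  have hdiv : ∀ x : ℝ, Filter.Tendsto (fun n : ℕ => x / (n : ℝ)) Filter.atTop (nhds 0) :=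
    fun x => tendsto_const_div_atTop_nhds_zero_nat x
  have hlim := hmain.add ((((((hdiv (1 + (J : ℝ) ^ 2 * 2)).add
    (hδ.const_mul ((J : ℝ) ^ 2 * 4))).const_mul (1 + (J : ℝ))).add hJ).const_mul
      ((K : ℝ) ^ 2)).add (hdiv ((K : ℝ) ^ 2 * (2 * K + 24))) |>.add
    ((((hτ.mul ((hδ.mul hm).add (hm.pow 2))).const_mul 16).add
      (((hδ.mul hm₁).const_mul (32 * (K₀ : ℝ))).add (hτ.const_mul 512))).add
      ((hδ.mul (hm₁.add (hm₁.pow 2))).const_mul 512)))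
  have hlt := hlim.eventually (gt_mem_nhds (lt_of_eq_of_lt (by ring) hc))
  filter_upwards [hlt, eventually_degCap_add_le, Filter.eventually_ge_atTop 8,
    eventually_sum_capLaw hf00 hfsum,
    (tendsto_wMean_capLaw hf00 hfsum (hsum1 K₀)).eventually (gt_mem_nhds hK₀)]
    with n h1 h2 h3 h4 h5
  refine lt_of_le_of_lt ?_ h1
  rw [expectedWork_eq]
  exact abs_iidMean_ecmWork_sub_le (fun t _ => capLaw_nonneg hf0 n t) h4 h3 h2 hK hK₀K hKJ h5.le
    rfl rfl rfl rfl _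

lemma tendsto_expectedWork (hf0 : ∀ t, 0 ≤ f t) (hf00 : f 0 = 0)
    (hfsum : HasSum f 1) (hmean : Summable fun t : ℕ => f t * (t : ℝ))
    (hmom : Summable fun t : ℕ => f t * (t : ℝ) ^ ((4 : ℝ) / 3)) :
    Filter.Tendsto (fun n : ℕ => 2 * expectedWork f n / n) Filter.atTop
      (nhds (∑' t : ℕ, (t : ℝ) * (t - 1) *
        (f t * (upperMean f t / ∑' s : ℕ, f s * (s : ℝ)) ^ 2))) := by
  set μ := ∑' s : ℕ, f s * (s : ℝ) with hμ
  have hsum : Summable fun t : ℕ => (t : ℝ) * (t - 1) * (f t * (upperMean f t / μ) ^ 2) := by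
    refine ((summable_upperMean_sq hf0 hmean hmom).div_const (μ ^ 2)).congr fun t => ?_
    rw [div_pow]
    ring
  have hLK := tendsto_sum_Icc_one hsum (by simp)
  set L := ∑' t : ℕ, (t : ℝ) * (t - 1) * (f t * (upperMean f t / μ) ^ 2) with hL
  have htail := (tendsto_tsum_tail hf0 (h := fun t => (t : ℝ) ^ ((4 : ℝ) / 3))
    (fun t => by positivity) hmom).const_mul
      (16 * (∑' t : ℕ, f t * (t : ℝ) ^ ((4 : ℝ) / 3)) ^ 2 + 512)
  rw [mul_zero] at htail
  have htail1 := tendsto_tsum_tail hf0 (h := fun t => (t : ℝ)) (fun t => Nat.cast_nonneg t) hmean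
  obtain ⟨K₀, hK₀⟩ := (htail1.eventually (gt_mem_nhds (by norm_num : (0 : ℝ) < 1 / 16))).exists
  refine Metric.tendsto_nhds.2 fun ε hε => ?_
  obtain ⟨K, hK1, hK2, hK3, hK4⟩ := ((htail.eventually (gt_mem_nhds (by positivity :
    (0 : ℝ) < ε / 4))).and ((Metric.tendsto_nhds.1 hLK (ε / 4) (by positivity)).and
    ((Filter.eventually_ge_atTop 12).and (Filter.eventually_ge_atTop K₀)))).exists
  have hJt := htail1.const_mul ((K : ℝ) ^ 2)
  rw [mul_zero] at hJt
  obtain ⟨J, hJ1, hJ2⟩ := ((hJt.eventually (gt_mem_nhds (by positivity :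
    (0 : ℝ) < ε / 4))).and (Filter.eventually_ge_atTop K)).exists
  filter_upwards [eventually_abs_expectedWork_sub_lt hf0 hf00 hfsum hmean hmom hK3 hK4 hJ2 hK₀
    (c := ε / 2) (by linarith)] with n hn
  rw [Real.dist_eq] at hK2 ⊢
  have := abs_sub_le (2 * expectedWork f n / n) (∑ t ∈ Finset.Icc 1 K, ((t : ℝ) * (t - 1)) *
    (f t * (upperMean f t / μ) ^ 2)) L
  linarith

lemma hasSum_triple (hf0 : ∀ t, 0 ≤ f t) (hmean : Summable fun t : ℕ => f t * (t : ℝ))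
    (hmom : Summable fun t : ℕ => f t * (t : ℝ) ^ ((4 : ℝ) / 3)) :
    HasSum (fun p : ℕ × ℕ × ℕ =>
        if p.1 ≤ p.2.1 ∧ p.1 ≤ p.2.2 then
          (p.1 : ℝ) * ((p.1 : ℝ) - 1) * (p.2.1 : ℝ) * (p.2.2 : ℝ) *
            f p.1 * f p.2.1 * f p.2.2
        else 0) (∑' t : ℕ, (t : ℝ) * (t - 1) * (f t * upperMean f t ^ 2)) := by
  set G : ℕ → ℕ → ℝ := fun t s => f s * if t ≤ s then (s : ℝ) else 0 with hG
  have hG0 : ∀ t s, 0 ≤ G t s := fun t s =>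
    mul_nonneg (hf0 s) (ite_le_nonneg_le _ (Nat.cast_nonneg s)).1
  have hGs : ∀ t, Summable (G t) := summable_upperMean hf0 hmean
  have e : (fun p : ℕ × ℕ × ℕ =>
        if p.1 ≤ p.2.1 ∧ p.1 ≤ p.2.2 then
          (p.1 : ℝ) * ((p.1 : ℝ) - 1) * (p.2.1 : ℝ) * (p.2.2 : ℝ) *
            f p.1 * f p.2.1 * f p.2.2
        else 0) = fun p => (p.1 : ℝ) * (p.1 - 1) * f p.1 * (G p.1 p.2.1 * G p.1 p.2.2) := by
    ext ⟨t, s, r⟩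
    simp only [hG]
    by_cases h1 : t ≤ s <;> by_cases h2 : t ≤ r <;> simp [h1, h2]
    ring
  have hprod : ∀ t, Summable fun q : ℕ × ℕ => G t q.1 * G t q.2 := fun t =>
    (hGs t).mul_of_nonneg (hGs t) (hG0 t) (hG0 t)
  have hin : ∀ t : ℕ, HasSum (fun q : ℕ × ℕ => (t : ℝ) * (t - 1) * f t * (G t q.1 * G t q.2))
      ((t : ℝ) * (t - 1) * (f t * upperMean f t ^ 2)) := by
    intro t
    have h := ((hGs t).hasSum.mul (hGs t).hasSum (hprod t)).mul_left ((t : ℝ) * (t - 1) * f t)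
    have e2 : (t : ℝ) * (t - 1) * (f t * upperMean f t ^ 2) =
        (t : ℝ) * (t - 1) * f t * ((∑' s, G t s) * ∑' s, G t s) := by
      rw [show upperMean f t = ∑' s, G t s from rfl]
      ring
    rw [e2]
    exact h
  have hsummable : Summable fun p : ℕ × ℕ × ℕ =>
      (p.1 : ℝ) * (p.1 - 1) * f p.1 * (G p.1 p.2.1 * G p.1 p.2.2) := by
    refine (summable_prod_of_nonneg fun p => ?_).2 ⟨fun t => (hin t).summable, ?_⟩
    · exact mul_nonneg (mul_nonneg (nat_mul_pred_nonneg _) (hf0 _))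
        (mul_nonneg (hG0 _ _) (hG0 _ _))
    · exact (summable_upperMean_sq hf0 hmean hmom).congr fun t => ((hin t).tsum_eq).symm
  rw [e]
  have h := hsummable.hasSum.prod_fiberwise hin
  rw [h.tsum_eq]
  exact hsummable.hasSum

end Limit

/-- Let `f` be a probability mass function on the positive integers with
finite mean `E[d]` and finite `4/3`-moment.  Draw `d_1, …, d_n` i.i.d. from `f` conditioned
on `{1, …, ⌊√n/(log n)²⌋}`, generate a graph from `ECM(d)`, and form MinBucket buckets
(edges between equal-degree endpoints going to both buckets).  Then
`(1/n) E[∑_i X_{i,n}(X_{i,n}-1)/2]` converges as `n → ∞` to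
`(1/(2 E[d]²)) ∑_{t₁=1}^∞ ∑_{t₂=t₁}^∞ ∑_{t₃=t₁}^∞ t₁(t₁-1) t₂ t₃ f(t₁) f(t₂) f(t₃)`,
which is a finite number (the triple sum is summable). -/
theorem minBucket_work_limit (f : ℕ → ℝ)
    (hf0 : ∀ t, 0 ≤ f t) (hf00 : f 0 = 0) (hfsum : HasSum f 1)
    (hmean : Summable fun t : ℕ => (t : ℝ) * f t)
    (hmom : Summable fun t : ℕ => (t : ℝ) ^ ((4 : ℝ) / 3) * f t) :
    Summable (fun p : ℕ × ℕ × ℕ =>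
        if p.1 ≤ p.2.1 ∧ p.1 ≤ p.2.2 then
          (p.1 : ℝ) * ((p.1 : ℝ) - 1) * (p.2.1 : ℝ) * (p.2.2 : ℝ) *
            f p.1 * f p.2.1 * f p.2.2
        else 0) ∧
      Filter.Tendsto (fun n : ℕ => (1 / (n : ℝ)) * expectedWork f n) Filter.atTop
        (nhds ((1 / (2 * (∑' t : ℕ, (t : ℝ) * f t) ^ 2)) *
          ∑' p : ℕ × ℕ × ℕ,
            if p.1 ≤ p.2.1 ∧ p.1 ≤ p.2.2 then
              (p.1 : ℝ) * ((p.1 : ℝ) - 1) * (p.2.1 : ℝ) * (p.2.2 : ℝ) *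
                f p.1 * f p.2.1 * f p.2.2
            else 0)) := by
  have hmean' : Summable fun t : ℕ => f t * (t : ℝ) := hmean.congr fun t => mul_comm _ _
  have hmom' : Summable fun t : ℕ => f t * (t : ℝ) ^ ((4 : ℝ) / 3) :=
    hmom.congr fun t => mul_comm _ _
  have hT := hasSum_triple hf0 hmean' hmom'
  refine ⟨hT.summable, ?_⟩
  rw [hT.tsum_eq]
  have h := (tendsto_expectedWork hf0 hf00 hfsum hmean' hmom').const_mul (1 / 2)
  have e : (∑' t : ℕ, (t : ℝ) * f t) = ∑' t : ℕ, f t * (t : ℝ) :=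
    tsum_congr fun t => mul_comm _ _
  rw [e]
  have e2 : ∑' t : ℕ, (t : ℝ) * (t - 1) *
        (f t * (upperMean f t / ∑' s : ℕ, f s * (s : ℝ)) ^ 2) =
      (∑' t : ℕ, (t : ℝ) * (t - 1) * (f t * upperMean f t ^ 2)) /
        (∑' s : ℕ, f s * (s : ℝ)) ^ 2 := by
    rw [← tsum_div_const]
    refine tsum_congr fun t => ?_
    rw [div_pow]
    ring
  rw [e2] at h
  convert h using 2
  · ring
  · ring
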